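/- Let {p_k/q_k} ⊂ (0,1) be a sequence of even rational parameters converging to an irrational limit, and let {B_k} be any sequence of associated blocks. Then for every integer N, for all sufficiently large k, the number of distinct plaid polygons contained in B_k exceeds N, and the maximum diameter of a plaid polygon contained in B_k exceeds N. -/

import Mathlib

noncomputable section
open scoped Classical

/-- The representative of `x` modulo `2ℤ` lying in `[-1,1)`.  For the values arising in the
plaid model (which are never congruent to an odd integer modulo `2ℤ`) this is the unique
representative in `(-1,1)`. -/
def nrm (x : ℝ) : ℝ := x - 2 * ⌊(x + 1) / 2⌋

/-- An even rational parameter `p/q`: coprime positive integers `p < q` with `p*q` even. -/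
structure Param where
  p : ℕ
  q : ℕ
  p_pos : 0 < p
  p_lt_q : p < q
  coprime : Nat.Coprime p q
  even_pq : Even (p * q)

/-- `z` lies on a line of the family `𝓗` (horizontal lines with integer `y`-coordinate). -/
def onH (z : ℝ × ℝ) : Prop := ∃ n : ℤ, z.2 = (n : ℝ)

/-- `z` lies on a line of the family `𝓥` (vertical lines with integer `x`-coordinate). -/
def onV (z : ℝ × ℝ) : Prop := ∃ n : ℤ, z.1 = (n : ℝ)

/-- The lightness condition on the pair of values `(F_A(z), F_B(z))`:
`F_A(z)·F_B(z) > 0` and `|F_B(z)| < |F_A(z)|`. -/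
def lightPair (a b : ℝ) : Prop := a * b > 0 ∧ |b| < |a|

namespace Param

variable (π : Param)

def ω : ℕ := π.p + π.q

def P : ℝ := 2 * π.p / π.ω

def Q : ℝ := 2 * π.q / π.ω

/-- `z` lies on a line of `𝓟` (slope `-P`, integer `y`-intercept). -/
def onP (z : ℝ × ℝ) : Prop := ∃ n : ℤ, z.2 + π.P * z.1 = (n : ℝ)

/-- `z` lies on a line of `𝓠` (slope `-Q`, integer `y`-intercept). -/
def onQ (z : ℝ × ℝ) : Prop := ∃ n : ℤ, z.2 + π.Q * z.1 = (n : ℝ)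

def FH (z : ℝ × ℝ) : ℝ := nrm (2 * π.P * z.2)
def FV (z : ℝ × ℝ) : ℝ := nrm (2 * π.P * z.1)
def FP (z : ℝ × ℝ) : ℝ := nrm (π.P * z.2 + π.P ^ 2 * z.1 + 1)
def FQ (z : ℝ × ℝ) : ℝ := nrm (π.P * z.2 + π.P * π.Q * z.1 + 1)

/-- `z` is a light intersection point of type `P` on a horizontal (`𝓗`) line. -/
def lightHP (z : ℝ × ℝ) : Prop := onH z ∧ π.onP z ∧ lightPair (π.FH z) (π.FP z)

/-- `z` is a light intersection point of type `Q` on a horizontal (`𝓗`) line. -/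
def lightHQ (z : ℝ × ℝ) : Prop := onH z ∧ π.onQ z ∧ lightPair (π.FH z) (π.FQ z)

/-- `z` is a light intersection point of type `P` on a vertical (`𝓥`) line. -/
def lightVP (z : ℝ × ℝ) : Prop := onV z ∧ π.onP z ∧ lightPair (π.FV z) (π.FP z)

/-- `z` is a light intersection point of type `Q` on a vertical (`𝓥`) line. -/
def lightVQ (z : ℝ × ℝ) : Prop := onV z ∧ π.onQ z ∧ lightPair (π.FV z) (π.FQ z)

/-- `z` is a light point (of some kind). -/
def light (z : ℝ × ℝ) : Prop := π.lightHP z ∨ π.lightHQ z ∨ π.lightVP z ∨ π.lightVQ z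

/-- The number of light points, with the double-counting convention (a light point which is the
midpoint of the segment, lying simultaneously on a `𝓟` line and a `𝓠` line, counts twice), on
the horizontal unit segment from `(m,n)` to `(m+1,n)`. -/
def hLightCount (m n : ℤ) : ℕ :=
  Set.ncard {x : ℝ | x ∈ Set.Icc (m : ℝ) ((m : ℝ) + 1) ∧ π.lightHP (x, (n : ℝ))} +
  Set.ncard {x : ℝ | x ∈ Set.Icc (m : ℝ) ((m : ℝ) + 1) ∧ π.lightHQ (x, (n : ℝ)) ∧
    (π.onP (x, (n : ℝ)) → x = (m : ℝ) + 1 / 2)}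

/-- The number of light points on the vertical unit segment from `(m,n)` to `(m,n+1)`. -/
def vLightCount (m n : ℤ) : ℕ :=
  Set.ncard {y : ℝ | y ∈ Set.Icc (n : ℝ) ((n : ℝ) + 1) ∧ π.lightVP ((m : ℝ), y)} +
  Set.ncard {y : ℝ | y ∈ Set.Icc (n : ℝ) ((n : ℝ) + 1) ∧ π.lightVQ ((m : ℝ), y)}

/-- The horizontal unit segment from `(m,n)` to `(m+1,n)` is good: it contains exactly one
light point (with the double-counting convention). -/
def goodH (m n : ℤ) : Prop := π.hLightCount m n = 1

/-- The vertical unit segment from `(m,n)` to `(m,n+1)` is good. -/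
def goodV (m n : ℤ) : Prop := π.vLightCount m n = 1

end Param

namespace Param

variable (π : Param)

/-- The capacity of the horizontal line `y = c` of `𝓗` — and likewise of the vertical line
`x = c` of `𝓥`, since `F_V` is given by the same formula: `ω·|F_H|`. -/
def cap (c : ℤ) : ℝ := π.ω * |nrm (2 * π.P * c)|

/-- The mass of the `𝓟` line with `y`-intercept `(0,c)` — and likewise of the `𝓠` line with
`y`-intercept `(0,c)`, since `F_P` and `F_Q` restrict to the same value on these lines. -/
def mass (c : ℤ) : ℝ := π.ω * |nrm (π.P * c + 1)|

/-- The block indexed by `(i,j)` : the translate of the square `[0,ω]²` by the lattice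
vector `(ω² i, ω j)`. -/
def block (i j : ℤ) : Set (ℝ × ℝ) :=
  Set.Icc ((π.ω : ℝ) ^ 2 * i, (π.ω : ℝ) * j) ((π.ω : ℝ) ^ 2 * i + π.ω, (π.ω : ℝ) * j + π.ω)

end Param

namespace Param

variable (π : Param)

/-- The union of all the plaid polygons: in each integer unit square (with corners `(m,n)` and
`(m+1,n+1)`) we draw the segments connecting the center of the square to the midpoints of its
good edges. -/
def plaidSet : Set (ℝ × ℝ) :=
  {z | ∃ m n : ℤ,
    (π.goodH m n ∧ z ∈ segment ℝ ((m : ℝ) + 1 / 2, (n : ℝ) + 1 / 2) ((m : ℝ) + 1 / 2, (n : ℝ))) ∨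
    (π.goodH m (n + 1) ∧
      z ∈ segment ℝ ((m : ℝ) + 1 / 2, (n : ℝ) + 1 / 2) ((m : ℝ) + 1 / 2, (n : ℝ) + 1)) ∨
    (π.goodV m n ∧ z ∈ segment ℝ ((m : ℝ) + 1 / 2, (n : ℝ) + 1 / 2) ((m : ℝ), (n : ℝ) + 1 / 2)) ∨
    (π.goodV (m + 1) n ∧
      z ∈ segment ℝ ((m : ℝ) + 1 / 2, (n : ℝ) + 1 / 2) ((m : ℝ) + 1, (n : ℝ) + 1 / 2))}

/-- A plaid polygon: a connected component of the union of the drawn segments. -/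
def IsPlaidPolygon (Γ : Set (ℝ × ℝ)) : Prop :=
  ∃ z ∈ π.plaidSet, Γ = connectedComponentIn π.plaidSet z

end Param


/-! ### Integer model -/

/-- representative mod `2w` in `[-w,w)` -/
def sm (w a : ℤ) : ℤ := a - 2 * w * ((a + w) / (2 * w))

lemma sm_bounds {w : ℤ} (hw : 0 < w) (a : ℤ) : -w ≤ sm w a ∧ sm w a < w := by
  have h1 := Int.emod_add_mul_ediv (a + w) (2 * w)
  have h2 := Int.emod_nonneg (a + w) (show (2 * w) ≠ 0 by omega)
  have h3 := Int.emod_lt_of_pos (a + w) (show 0 < (2 * w) by omega)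
  unfold sm
  constructor <;> linarith

lemma sm_unique {w : ℤ} (hw : 0 < w) (a t r : ℤ) (h : a = r + 2 * w * t) (h1 : -w ≤ r)
    (h2 : r < w) : sm w a = r := by
  have : (a + w) / (2 * w) = t := by
    rw [h, show r + 2 * w * t + w = (r + w) + t * (2 * w) by ring,
      Int.add_mul_ediv_right _ _ (by omega), Int.ediv_eq_zero_of_lt (by omega) (by omega)]
    simp
  unfold sm
  rw [this, h]; ring

lemma sm_add_mul {w : ℤ} (hw : 0 < w) (a t : ℤ) : sm w (a + 2 * w * t) = sm w a := by
  obtain ⟨h1, h2⟩ := sm_bounds hw a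
  apply sm_unique hw _ (t + (a + w) / (2 * w)) _ _ h1 h2
  unfold sm; ring

/-- integer lightness -/
def LI (w a b : ℤ) : Prop := 0 < sm w a * sm w b ∧ |sm w b| < |sm w a|

lemma LI_iff (w a b : ℤ) : LI w a b ↔
    (0 < sm w b ∧ sm w b < sm w a) ∨ (sm w a < sm w b ∧ sm w b < 0) := by
  unfold LI
  constructor
  · rintro ⟨h1, h2⟩
    rcases pos_and_pos_or_neg_and_neg_of_mul_pos h1 with ⟨ha, hb⟩ | ⟨ha, hb⟩
    · rw [abs_of_pos ha, abs_of_pos hb] at h2; exact Or.inl ⟨hb, h2⟩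
    · rw [abs_of_neg ha, abs_of_neg hb] at h2; exact Or.inr ⟨by omega, hb⟩
  · rintro (⟨h1, h2⟩ | ⟨h1, h2⟩)
    · have : 0 < sm w a := by omega
      exact ⟨by positivity, by rw [abs_of_pos h1, abs_of_pos this]; exact h2⟩
    · have : sm w a < 0 := by omega
      exact ⟨mul_pos_of_neg_of_neg this h2, by rw [abs_of_neg h2, abs_of_neg this]; omega⟩

/-- The light predicate: line number `l` (horizontal or vertical), oblique line intercept `c`. -/
def Lt (w p l c : ℤ) : Prop := LI w (4 * p * l) (2 * p * c + w)

def GG (w p d : ℤ) : ZMod 2 := (((2 * p * d + w) / (2 * w) : ℤ) : ZMod 2)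
def NN (w p l : ℤ) : ZMod 2 := (((4 * p * l + w) / (2 * w) : ℤ) : ZMod 2)

lemma two_zmod (t : ZMod 2) : t + t = 0 := by revert t; decide

lemma ediv_between {x y t : ℤ} (h1 : y * t ≤ x) (h2 : x < y * t + y) (hy : 0 < y) : x / y = t := by
  apply le_antisymm
  · apply Int.lt_add_one_iff.mp
    apply Int.ediv_lt_of_lt_mul hy; nlinarith
  · apply Int.le_ediv_of_mul_le hy; nlinarith

lemma Lt_parity {w : ℤ} (hw : 0 < w) (hodd : w % 2 = 1) (p l c : ℤ) :
    (if Lt w p l c then (1 : ZMod 2) else 0) = GG w p c + GG w p (c - 2 * l) + NN w p l := by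
  unfold Lt
  rw [if_congr (LI_iff _ _ _) rfl rfl]
  unfold GG NN
  set a := 4 * p * l with ha
  set b := 2 * p * c + w with hb
  have hba : 2 * p * (c - 2 * l) + w = b - a := by rw [ha, hb]; ring
  rw [hba]
  set N := (a + w) / (2 * w) with hN
  set B := b / (2 * w) with hB
  have hsa : sm w a = a - 2 * w * N := rfl
  obtain ⟨hsa1, hsa2⟩ := sm_bounds hw a
  have h1 := Int.emod_add_mul_ediv b (2 * w)
  have h2 := Int.emod_nonneg b (show (2 * w) ≠ 0 by omega)
  have h3 := Int.emod_lt_of_pos b (show 0 < (2 * w) by omega)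
  rw [← hB] at h1
  set r := b % (2 * w) with hr
  have hrodd : r % 2 = 1 := by
    have : b % 2 = 1 := by rw [hb, mul_assoc]; omega
    have h4 : r = b - 2 * (w * B) := by linarith
    omega
  set s := sm w a with hs
  have hseven : s % 2 = 0 := by
    have h4 : s = 2 * (2 * (p * l)) - 2 * (w * N) := by rw [hsa, ha]; ring
    omega
  have hba' : b - a = (r - s) + (B - N) * (2 * w) := by
    rw [← h1, hsa]; ring
  have hdiv : (b - a) / (2 * w) = (r - s) / (2 * w) + (B - N) := by
    rw [hba', Int.add_mul_ediv_right _ _ (by omega)]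
  rw [hdiv]
  have hsum : ∀ e : ℤ, ((B : ℤ) : ZMod 2) + ((e + (B - N) : ℤ) : ZMod 2) + ((N : ℤ) : ZMod 2)
      = (e : ZMod 2) := by
    intro e; push_cast
    linear_combination two_zmod (B : ZMod 2)
  rw [hsum]
  by_cases hrw : r < w
  · have hsb : sm w b = r := sm_unique hw _ B _ (by linarith) (by omega) (by omega)
    rw [hsb]
    by_cases hlt : r < s
    · rw [if_pos (Or.inl ⟨by omega, hlt⟩)]
      rw [ediv_between (t := -1) (by linarith) (by linarith) (by omega)]
      decide
    · rw [if_neg (by omega)]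
      rw [ediv_between (t := 0) (by linarith) (by linarith) (by omega)]
      decide
  · have hsb : sm w b = r - 2 * w := sm_unique hw _ (B + 1) _ (by linarith) (by omega) (by omega)
    rw [hsb]
    by_cases hlt : s < r - 2 * w
    · rw [if_pos (Or.inr ⟨by omega, by omega⟩)]
      rw [ediv_between (t := 1) (by linarith) (by linarith) (by omega)]
      decide
    · rw [if_neg (by omega)]
      have : r - 2 * w ≠ s := by omega
      rw [ediv_between (t := 0) (by linarith) (by omega) (by omega)]
      decide

lemma GG_neg {w : ℤ} (hw : 0 < w) (hodd : w % 2 = 1) (p d : ℤ) : GG w p (-d) = GG w p d := by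
  unfold GG
  set b := 2 * p * d + w with hb
  have h1 := Int.emod_add_mul_ediv b (2 * w)
  have h2 := Int.emod_nonneg b (show (2 * w) ≠ 0 by omega)
  have h3 := Int.emod_lt_of_pos b (show 0 < (2 * w) by omega)
  set B := b / (2 * w) with hB
  set r := b % (2 * w) with hr
  have hrodd : r % 2 = 1 := by
    have : b % 2 = 1 := by rw [hb, mul_assoc]; omega
    have h4 : r = b - 2 * (w * B) := by linarith
    omega
  have : 2 * p * (-d) + w = 2 * w - b := by rw [hb]; ring
  rw [this]
  have h0 : 0 < r := by omega
  have : (2 * w - b) / (2 * w) = - B := by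
    apply ediv_between <;> nlinarith
  rw [this]; push_cast
  linear_combination -two_zmod (B : ZMod 2)

lemma Lt_reflect {w : ℤ} (hw : 0 < w) (hodd : w % 2 = 1) (p l c : ℤ) :
    Lt w p l (2 * l - c) ↔ Lt w p l c := by
  have h1 := Lt_parity hw hodd p l c
  have h2 := Lt_parity hw hodd p l (2 * l - c)
  rw [show 2 * l - c - 2 * l = -c by ring, GG_neg hw hodd,
    show 2 * l - c = -(c - 2 * l) by ring, GG_neg hw hodd] at h2
  rw [show 2 * l - c = -(c - 2 * l) by ring]
  have h3 : (if Lt w p l (-(c - 2 * l)) then (1 : ZMod 2) else 0) = if Lt w p l c then 1 else 0 := by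
    rw [h1, h2]; ring
  clear h1 h2
  generalize -(c - 2 * l) = c' at h3 ⊢
  by_cases h : Lt w p l c <;> by_cases h' : Lt w p l c' <;> simp [h, h'] at h3 ⊢

lemma Lt_period {w : ℤ} (hw : 0 < w) (p l c t : ℤ) :
    Lt w p l (c + w * t) ↔ Lt w p l c := by
  unfold Lt LI
  rw [show 2 * p * (c + w * t) + w = (2 * p * c + w) + 2 * w * (p * t) by ring, sm_add_mul hw]

/-- `0/1` valued version -/
def el (w p l c : ℤ) : ℕ := if Lt w p l c then 1 else 0

lemma el_cast {w : ℤ} (hw : 0 < w) (hodd : w % 2 = 1) (p l c : ℤ) :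
    ((el w p l c : ℕ) : ZMod 2) = GG w p c + GG w p (c - 2 * l) + NN w p l := by
  rw [← Lt_parity hw hodd]; unfold el; split_ifs <;> simp

lemma el_le (w p l c : ℤ) : el w p l c ≤ 1 := by unfold el; split_ifs <;> simp

def fl (w p m : ℤ) : ℤ := 2 * p * m / w

/-- number of light points on horizontal unit segment -/
def hc (w p m n : ℤ) : ℕ :=
  ∑ k ∈ Finset.Ioc (fl w p m) (fl w p (m + 1)), el w p n (n + k) +
  ∑ k ∈ Finset.Ioc (2 * m - 1 - fl w p m) (2 * (m + 1) - 1 - fl w p (m + 1)), el w p n (n + k)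

def vc (w p m n : ℤ) : ℕ := el w p m (n + fl w p m + 1) + el w p m (n + 2 * m - fl w p m)

lemma fl_bounds {w : ℤ} (hw : 0 < w) (p m : ℤ) :
    w * fl w p m ≤ 2 * p * m ∧ 2 * p * m < w * fl w p m + w := by
  have h1 := Int.emod_add_mul_ediv (2 * p * m) w
  have h2 := Int.emod_nonneg (2 * p * m) (show w ≠ 0 by omega)
  have h3 := Int.emod_lt_of_pos (2 * p * m) hw
  unfold fl; constructor <;> linarith

lemma fl_step {w p : ℤ} (hp : 0 < p) (hpw : 2 * p < w) (m : ℤ) :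
    fl w p (m + 1) = fl w p m ∨ fl w p (m + 1) = fl w p m + 1 := by
  have hw : 0 < w := by omega
  obtain ⟨h1, h2⟩ := fl_bounds hw p m
  by_cases h : 2 * p * m + 2 * p < w * fl w p m + w
  · left
    show 2 * p * (m + 1) / w = _
    apply ediv_between <;> linarith
  · right
    show 2 * p * (m + 1) / w = _
    apply ediv_between <;> linarith

lemma Ioc_one (a : ℤ) : Finset.Ioc a (a + 1) = {a + 1} := by
  ext x; simp; omega
lemma Ioc_two (a : ℤ) : Finset.Ioc a (a + 2) = {a + 1, a + 2} := by
  ext x; simp; omega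

lemma hc_A {w p m : ℤ} (h : fl w p (m + 1) = fl w p m) (n : ℤ) :
    hc w p m n = el w p n (n + 2 * m - fl w p m) + el w p n (n + 2 * m - fl w p m + 1) := by
  unfold hc
  rw [h, show 2 * (m + 1) - 1 - fl w p m = 2 * m - 1 - fl w p m + 2 by ring, Ioc_two,
    Finset.sum_pair (by omega)]
  simp only [Finset.Ioc_self, Finset.sum_empty, zero_add]
  congr 2 <;> ring

lemma hc_B {w p m : ℤ} (h : fl w p (m + 1) = fl w p m + 1) (n : ℤ) :
    hc w p m n = el w p n (n + fl w p m + 1) + el w p n (n + 2 * m - fl w p m) := by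
  unfold hc
  rw [h, show 2 * (m + 1) - 1 - (fl w p m + 1) = 2 * m - 1 - fl w p m + 1 by ring, Ioc_one, Ioc_one,
    Finset.sum_singleton, Finset.sum_singleton]
  congr 2 <;> ring

lemma hc_le {w p : ℤ} (hp : 0 < p) (hpw : 2 * p < w) (m n : ℤ) : hc w p m n ≤ 2 := by
  rcases fl_step hp hpw m with h | h
  · rw [hc_A h]; exact add_le_add (el_le _ _ _ _) (el_le _ _ _ _)
  · rw [hc_B h]; exact add_le_add (el_le _ _ _ _) (el_le _ _ _ _)

lemma vc_le (w p m n : ℤ) : vc w p m n ≤ 2 :=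
  add_le_add (el_le _ _ _ _) (el_le _ _ _ _)

lemma square_parity {w p : ℤ} (hp : 0 < p) (hpw : 2 * p < w) (hodd : w % 2 = 1) (m n : ℤ) :
    ((hc w p m n : ℕ) : ZMod 2) + (hc w p m (n + 1) : ℕ) + (vc w p m n : ℕ)
      + (vc w p (m + 1) n : ℕ) = 0 := by
  have hw : 0 < w := by omega
  set i := fl w p m with hi
  rcases fl_step hp hpw m with h | h
  · rw [hc_A h, hc_A h]; unfold vc; rw [h]
    push_cast
    simp only [el_cast hw hodd, ← hi]
    have e1 : GG w p (n + i + 1 - 2 * m) = GG w p (n + 2 * m - i + 1 - 2 * (n + 1)) := by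
      rw [← GG_neg hw hodd]; congr 1; ring
    have e2 : GG w p (n + i + 1 - 2 * (m + 1)) = GG w p (n + 2 * m - i + 1 - 2 * n) := by
      rw [← GG_neg hw hodd]; congr 1; ring
    rw [e1, e2, show n + 1 + 2 * m - i = n + 2 * m - i + 1 by ring,
      show n + 2 * (m + 1) - i = n + 2 * m - i + 1 + 1 by ring,
      show n + 2 * m - i + 1 + 1 - 2 * (n + 1) = n + 2 * m - i - 2 * n by ring,
      show n + 2 * m - i + 1 + 1 - 2 * (m + 1) = n + 2 * m - i - 2 * m by ring]
    generalize GG w p (n + 2 * m - i + 1 - 2 * (n + 1)) = x1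
    generalize GG w p (n + 2 * m - i + 1 - 2 * n) = x2
    generalize GG w p (n + 2 * m - i - 2 * n) = x3
    generalize GG w p (n + 2 * m - i - 2 * m) = x4
    generalize GG w p (n + 2 * m - i + 1 + 1) = x5
    generalize GG w p (n + 2 * m - i + 1) = x6
    generalize GG w p (n + 2 * m - i) = x7
    generalize GG w p (n + i + 1) = x8
    generalize NN w p n = x9
    generalize NN w p (n + 1) = x10
    generalize NN w p m = x11
    generalize NN w p (m + 1) = x12
    have h2 : (2 : ZMod 2) = 0 := rfl
    linear_combination (x1 + x2 + x3 + x4 + x5 + x6 + x7 + x8 + x9 + x10 + x11 + x12) * h2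
  · rw [hc_B h, hc_B h]; unfold vc; rw [h]
    push_cast
    simp only [el_cast hw hodd, ← hi]
    rw [show n + 1 + i + 1 = n + i + 2 by ring,
      show n + 1 + 2 * m - i = n + 2 * m - i + 1 by ring,
      show n + (i + 1) + 1 = n + i + 2 by ring,
      show n + 2 * (m + 1) - (i + 1) = n + 2 * m - i + 1 by ring]
    have e1 : GG w p (n + i + 1 - 2 * m) = GG w p (n + 2 * m - i + 1 - 2 * (n + 1)) := by
      rw [← GG_neg hw hodd]; congr 1; ring
    have e2 : GG w p (n + i + 1 - 2 * n) = GG w p (n + 2 * m - i + 1 - 2 * (m + 1)) := by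
      rw [← GG_neg hw hodd]; congr 1; ring
    have e3 : GG w p (n + i + 2 - 2 * (n + 1)) = GG w p (n + 2 * m - i - 2 * m) := by
      rw [← GG_neg hw hodd]; congr 1; ring
    have e4 : GG w p (n + i + 2 - 2 * (m + 1)) = GG w p (n + 2 * m - i - 2 * n) := by
      rw [← GG_neg hw hodd]; congr 1; ring
    rw [e1, e2, e3, e4]
    generalize GG w p (n + 2 * m - i + 1 - 2 * (n + 1)) = x1
    generalize GG w p (n + 2 * m - i + 1 - 2 * (m + 1)) = x2
    generalize GG w p (n + 2 * m - i - 2 * n) = x3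
    generalize GG w p (n + 2 * m - i - 2 * m) = x4
    generalize GG w p (n + i + 2) = x5
    generalize GG w p (n + 2 * m - i + 1) = x6
    generalize GG w p (n + 2 * m - i) = x7
    generalize GG w p (n + i + 1) = x8
    generalize NN w p n = x9
    generalize NN w p (n + 1) = x10
    generalize NN w p m = x11
    generalize NN w p (m + 1) = x12
    have h2 : (2 : ZMod 2) = 0 := rfl
    linear_combination (x1 + x2 + x3 + x4 + x5 + x6 + x7 + x8 + x9 + x10 + x11 + x12) * h2

/-! ### Counting -/

lemma sum_Ioc_telescope (f : ℕ → ℤ) (r : ℕ) (hf : ∀ i < r, f i ≤ f (i + 1)) (φ : ℤ → ℕ) :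
    ∑ i ∈ Finset.range r, ∑ k ∈ Finset.Ioc (f i) (f (i + 1)), φ k
      = ∑ k ∈ Finset.Ioc (f 0) (f r), φ k ∧ f 0 ≤ f r := by
  induction r with
  | zero => simp
  | succ r ih =>
    obtain ⟨h1, h2⟩ := ih (fun i hi => hf i (by omega))
    have h3 := hf r (by omega)
    refine ⟨?_, h2.trans h3⟩
    rw [Finset.sum_range_succ, h1, ← Finset.sum_union]
    · rw [Finset.Ioc_union_Ioc_eq_Ioc h2 h3]
    · rw [Finset.disjoint_left]; intro x; simp; omega

lemma sum_Ico_telescope (f : ℕ → ℤ) (r : ℕ) (hf : ∀ i < r, f i ≤ f (i + 1)) (φ : ℤ → ℕ) :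
    ∑ i ∈ Finset.range r, ∑ k ∈ Finset.Ico (f i) (f (i + 1)), φ k
      = ∑ k ∈ Finset.Ico (f 0) (f r), φ k ∧ f 0 ≤ f r := by
  induction r with
  | zero => simp
  | succ r ih =>
    obtain ⟨h1, h2⟩ := ih (fun i hi => hf i (by omega))
    have h3 := hf r (by omega)
    refine ⟨?_, h2.trans h3⟩
    rw [Finset.sum_range_succ, h1, ← Finset.sum_union]
    · rw [Finset.Ico_union_Ico_eq_Ico h2 h3]
    · rw [Finset.disjoint_left]; intro x; simp; omega

lemma sum_Ico_range (a : ℤ) (r : ℕ) (φ : ℤ → ℕ) :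
    ∑ k ∈ Finset.Ico a (a + r), φ k = ∑ i ∈ Finset.range r, φ (a + i) := by
  have h := (sum_Ico_telescope (fun i => a + i) r (fun i _ => by push_cast; omega) φ).1
  simp only [Nat.cast_zero, add_zero] at h
  rw [← h]
  apply Finset.sum_congr rfl
  intro i _
  have : Finset.Ico (a + (i : ℤ)) (a + ((i + 1 : ℕ) : ℤ)) = {a + (i : ℤ)} := by
    ext x; simp; omega
  rw [this, Finset.sum_singleton]

lemma sum_Ioc_shift (a b t : ℤ) (φ : ℤ → ℕ) :
    ∑ k ∈ Finset.Ioc a b, φ (t + k) = ∑ k ∈ Finset.Ioc (t + a) (t + b), φ k := by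
  apply Finset.sum_bij (fun k _ => t + k)
  · intro k; simp
  · intro a _ b _ h; simpa using h
  · intro b hb; refine ⟨b - t, ?_, by ring⟩; simp at hb ⊢; omega
  · intro a _; rfl

lemma sum_Ioc_reflect (a b t : ℤ) (φ : ℤ → ℕ) :
    ∑ k ∈ Finset.Ioc a b, φ (t - k) = ∑ k ∈ Finset.Ioc (t - b - 1) (t - a - 1), φ k := by
  apply Finset.sum_bij (fun k _ => t - k)
  · intro k; simp; omega
  · intro a _ b _ h; simpa using h
  · intro b hb; refine ⟨t - b, ?_, by ring⟩; simp at hb ⊢; omega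
  · intro a _; rfl

lemma sum_Ioc_split (a b c : ℤ) (hab : a ≤ b) (hbc : b ≤ c) (φ : ℤ → ℕ) :
    ∑ k ∈ Finset.Ioc a c, φ k = ∑ k ∈ Finset.Ioc a b, φ k + ∑ k ∈ Finset.Ioc b c, φ k := by
  rw [← Finset.sum_union, Finset.Ioc_union_Ioc_eq_Ioc hab hbc]
  rw [Finset.disjoint_left]; intro x; simp; omega

lemma sm_congr_dvd {w a b : ℤ} (h : sm w a = sm w b) : 2 * w ∣ a - b := by
  unfold sm at h
  exact ⟨(a + w) / (2 * w) - (b + w) / (2 * w), by linear_combination h⟩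

lemma sm_even (w p l : ℤ) : sm w (4 * p * l) % 2 = 0 := by
  unfold sm
  rw [show 4 * p * l - 2 * w * ((4 * p * l + w) / (2 * w)) = 2 * (2 * (p * l) - w * ((4 * p * l + w) / (2 * w))) by ring]
  omega

lemma sm_odd {w : ℤ} (hodd : w % 2 = 1) (p c : ℤ) : sm w (2 * p * c + w) % 2 = 1 := by
  unfold sm
  generalize (2 * p * c + w + w) / (2 * w) = t
  rw [show 2 * p * c + w - 2 * w * t = 2 * (p * c - w * t) + w by ring]
  omega

/-- At most `cap/2` light classes in a window of length `w`. -/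
lemma el_window {w p : ℤ} (hw : 0 < w) (hodd : w % 2 = 1) (hcop : IsCoprime (2 * p) w) (l a : ℤ) :
    2 * ∑ c ∈ Finset.Ioc a (a + w), el w p l c ≤ (sm w (4 * p * l)).natAbs := by
  have hev := sm_even w p l
  unfold el
  rw [← Finset.card_filter]
  have : ((Finset.Ioc a (a + w)).filter (fun c => Lt w p l c)).card
      ≤ (Finset.range ((sm w (4 * p * l)).natAbs / 2)).card := by
    apply Finset.card_le_card_of_injOn (fun c => (sm w (2 * p * c + w)).natAbs / 2)
    · intro c hc
      simp only [Finset.coe_filter, Set.mem_ofPred_eq, Finset.mem_Ioc] at hc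
      have h := (LI_iff _ _ _).mp hc.2
      have := sm_odd hodd p c
      simp only [Finset.coe_range, Set.mem_Iio]
      omega
    · intro c hc d hd hcd
      simp only [Finset.coe_filter, Set.mem_ofPred_eq, Finset.mem_Ioc] at hc hd
      have h1 := (LI_iff _ _ _).mp hc.2
      have h2 := (LI_iff _ _ _).mp hd.2
      have h3 := sm_odd hodd p c
      have h4 := sm_odd hodd p d
      simp only at hcd
      have h5 : sm w (2 * p * c + w) = sm w (2 * p * d + w) := by omega
      have h6 := sm_congr_dvd h5
      have h7 : w ∣ 2 * p * (c - d) := by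
        refine dvd_trans ⟨2, by ring⟩ (h6.trans ⟨1, by ring⟩)
      have h8 : w ∣ c - d := hcop.symm.dvd_of_dvd_mul_left h7
      obtain ⟨t, ht⟩ := h8
      have : t = 0 := by
        by_contra hne
        rcases lt_or_gt_of_ne hne with h | h
        · have : t ≤ -1 := by omega
          nlinarith [hc.1.1, hc.1.2, hd.1.1, hd.1.2]
        · have : 1 ≤ t := by omega
          nlinarith [hc.1.1, hc.1.2, hd.1.1, hd.1.2]
      subst this; omega
  rw [Finset.card_range] at this
  omega

lemma fl_mul {w : ℤ} (hw : 0 < w) (p M : ℤ) : fl w p (w * M) = 2 * p * M := by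
  unfold fl
  rw [show 2 * p * (w * M) = (2 * p * M) * w by ring]
  exact Int.mul_ediv_cancel _ (by omega)

lemma el_reflect {w : ℤ} (hw : 0 < w) (hodd : w % 2 = 1) (p l c : ℤ) :
    el w p l (2 * l - c) = el w p l c := by
  unfold el; rw [if_congr (Lt_reflect hw hodd p l c) rfl rfl]

lemma el_period {w : ℤ} (hw : 0 < w) (p l c t : ℤ) :
    el w p l (c + w * t) = el w p l c := by
  unfold el; rw [if_congr (Lt_period hw p l c t) rfl rfl]

lemma hc_total {w p : ℤ} (hp : 0 < p) (hpw : 2 * p < w) (hodd : w % 2 = 1)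
    (hcop : IsCoprime (2 * p) w) (M n : ℤ) :
    ∑ m ∈ Finset.Ico (w * M) (w * M + w), hc w p m n ≤ (sm w (4 * p * n)).natAbs := by
  have hw : 0 < w := by omega
  obtain ⟨W, rfl⟩ := Int.eq_ofNat_of_zero_le hw.le
  set w : ℤ := (W : ℤ) with hwdef
  rw [sum_Ico_range]
  unfold hc
  rw [Finset.sum_add_distrib]
  have t1 := (sum_Ioc_telescope (fun i => fl w p (w * M + i)) W (fun i _ => by
    push_cast; rcases fl_step hp hpw (w * M + i) with h | h <;> rw [← add_assoc, h]; omega)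
    (fun k => el w p n (n + k))).1
  have t2 := (sum_Ioc_telescope (fun i => 2 * (w * M + i) - 1 - fl w p (w * M + i)) W (fun i _ => by
    push_cast; rcases fl_step hp hpw (w * M + i) with h | h <;> rw [← add_assoc, h] <;> omega)
    (fun k => el w p n (n + k))).1
  push_cast at t1 t2
  simp only [← add_assoc] at t1 t2
  rw [t1, t2]
  rw [add_zero, ← hwdef, show w * M + w = w * (M + 1) by ring, fl_mul hw, fl_mul hw]
  have r1 : ∑ k ∈ Finset.Ioc (2 * p * M) (2 * p * (M + 1)), el w p n (n + k)
      = ∑ k ∈ Finset.Ioc (2 * (w * M) - 1 - 2 * p * M - 2 * p) (2 * (w * M) - 1 - 2 * p * M),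
        el w p n (n + k) := by
    rw [show 2 * (w * M) - 1 - 2 * p * M - 2 * p = 2 * (w * M) - 2 * p * (M + 1) - 1 by ring,
      show 2 * (w * M) - 1 - 2 * p * M = 2 * (w * M) - 2 * p * M - 1 by ring,
      ← sum_Ioc_reflect]
    apply Finset.sum_congr rfl
    intro k _
    rw [show n + (2 * (w * M) - k) = (2 * n - (n + k)) + w * (2 * M) by ring, el_period hw,
      el_reflect hw hodd]
  rw [r1, ← sum_Ioc_split _ _ _ (by omega) (by nlinarith), sum_Ioc_shift]
  have h1 := el_window hw hodd hcop n (n + (2 * (w * M) - 1 - 2 * p * M - 2 * p))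
  have h2 := el_window hw hodd hcop n (n + (2 * (w * M) - 1 - 2 * p * M - 2 * p) + w)
  rw [show n + (2 * (w * (M + 1)) - 1 - 2 * p * (M + 1)) =
    n + (2 * (w * M) - 1 - 2 * p * M - 2 * p) + w + w by ring,
    sum_Ioc_split _ (n + (2 * (w * M) - 1 - 2 * p * M - 2 * p) + w) _ (by omega) (by omega)]
  omega

lemma vc_total {w p : ℤ} (hw : 0 < w) (hodd : w % 2 = 1)
    (hcop : IsCoprime (2 * p) w) (m n0 : ℤ) :
    ∑ n ∈ Finset.Ico n0 (n0 + w), vc w p m n ≤ (sm w (4 * p * m)).natAbs := by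
  unfold vc
  rw [Finset.sum_add_distrib]
  have key : ∀ t : ℤ, 2 * ∑ n ∈ Finset.Ico n0 (n0 + w), el w p m (t + n)
      ≤ (sm w (4 * p * m)).natAbs := by
    intro t
    have := el_window hw hodd hcop m (t - 1 + n0)
    rw [add_assoc (t - 1), ← sum_Ioc_shift] at this
    refine le_trans (le_of_eq ?_) this
    congr 1
    apply Finset.sum_bij (fun k _ => k + 1)
    · intro k; simp
    · intro a _ b _ h; simpa using h
    · intro b hb; refine ⟨b - 1, ?_, by ring⟩; simp at hb ⊢; omega
    · intro a _; congr 1; ring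
  have h1 := key (fl w p m + 1)
  have h2 := key (2 * m - fl w p m)
  have e1 : ∑ n ∈ Finset.Ico n0 (n0 + w), el w p m (n + fl w p m + 1)
    = ∑ n ∈ Finset.Ico n0 (n0 + w), el w p m (fl w p m + 1 + n) := by
    apply Finset.sum_congr rfl; intro k _; congr 1; ring
  have e2 : ∑ n ∈ Finset.Ico n0 (n0 + w), el w p m (n + 2 * m - fl w p m)
    = ∑ n ∈ Finset.Ico n0 (n0 + w), el w p m (2 * m - fl w p m + n) := by
    apply Finset.sum_congr rfl; intro k _; congr 1; ring
  rw [e1, e2]; omega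

/-! ### Sparse lines and an empty cell -/

lemma sorted_seq (x0 : ℤ) (L : Finset ℤ) : ∀ (x1 : ℤ), (∀ l ∈ L, x0 < l ∧ l < x1) → x0 < x1 →
    ∃ x : ℕ → ℤ, x 0 = x0 ∧ x (L.card + 1) = x1 ∧ (∀ i < L.card + 1, x i < x (i + 1)) ∧
      (∀ i < L.card + 1, ∀ l ∈ L, ¬ (x i < l ∧ l < x (i + 1))) ∧
      (∀ i ≤ L.card + 1, x i ∈ L ∨ x i = x0 ∨ x i = x1) ∧
      (∀ φ : ℤ → ℕ, ∑ i ∈ Finset.range L.card, φ (x (i + 1)) = ∑ l ∈ L, φ l) := by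
  induction L using Finset.induction_on_max with
  | empty =>
    intro x1 _ h
    refine ⟨fun i => if i = 0 then x0 else x1, by simp, by simp, ?_, ?_, ?_, ?_⟩
    · intro i hi; simp at hi; subst hi; simpa using h
    · simp
    · intro i _; by_cases h : i = 0 <;> simp [h]
    · simp
  | insert a s hs ih =>
    intro x1 hL h
    have ha : x0 < a ∧ a < x1 := hL a (by simp)
    have hna : a ∉ s := fun h => lt_irrefl _ (hs a h)
    obtain ⟨x, e0, e1, h1, h2, h3, h4⟩ := ih a
      (fun l hl => ⟨(hL l (by simp [hl])).1, hs l hl⟩) ha.1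
    rw [Finset.card_insert_of_notMem hna]
    refine ⟨fun i => if i ≤ s.card + 1 then x i else x1, by simp [e0], by simp, ?_, ?_, ?_, ?_⟩
    · intro i hi
      by_cases hi' : i < s.card + 1
      · simp only [hi'.le, if_true, show i + 1 ≤ s.card + 1 by omega]; exact h1 i hi'
      · have : i = s.card + 1 := by omega
        subst this; simp [e1, ha.2]
    · intro i hi l hl
      by_cases hi' : i < s.card + 1
      · simp only [hi'.le, if_true, show i + 1 ≤ s.card + 1 by omega]
        rcases Finset.mem_insert.mp hl with rfl | hl
        · intro hh
          have hmono : ∀ j k, j + k = s.card + 1 → x j ≤ l := by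
            intro j k
            induction k generalizing j with
            | zero => intro hjk; simp at hjk; rw [hjk, e1]
            | succ k ihk => intro hjk; exact (h1 j (by omega)).le.trans (ihk (j + 1) (by omega))
          have := hmono (i + 1) (s.card - i) (by omega)
          omega
        · exact h2 i hi' l hl
      · have : i = s.card + 1 := by omega
        subst this; simp only [le_refl, if_true, e1]
        rcases Finset.mem_insert.mp hl with rfl | hl
        · simp
        · have := hs l hl; omega
    · intro i hi
      by_cases hi' : i ≤ s.card + 1
      · simp only [hi', if_true]
        rcases h3 i hi' with h | h | h
        · left; simp [h]
        · simp [h]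
        · left; simp [h]
      · simp [hi']
    · intro φ
      rw [Finset.sum_range_succ, Finset.sum_insert hna, ← h4 φ, add_comm]
      congr 1
      · simp [e1]
      · apply Finset.sum_congr rfl
        intro i hi
        simp at hi
        simp [show i ≤ s.card by omega]

lemma strip_sum (f : ℤ → ZMod 2) (c : ℤ) (S : ℕ) :
    ∑ n ∈ Finset.Ico c (c + S), (f n + f (n + 1)) = f c + f (c + S) := by
  induction S with
  | zero => simp [two_zmod]
  | succ S ih =>
    have : Finset.Ico c (c + (S + 1 : ℕ)) = insert (c + S) (Finset.Ico c (c + S)) := by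
      ext k; simp; omega
    rw [this, Finset.sum_insert (by simp), ih]
    have e : c + ((S + 1 : ℕ) : ℤ) = c + S + 1 := by push_cast; ring
    rw [e]
    linear_combination two_zmod (f (c + S))

lemma rect_parity (H V : ℤ → ℤ → ZMod 2) (a b c d : ℤ) (hab : a ≤ b) (hcd : c ≤ d)
    (hsq : ∀ m n, a ≤ m → m < b → c ≤ n → n < d → H m n + H m (n + 1) + V m n + V (m + 1) n = 0) :
    ∑ m ∈ Finset.Ico a b, H m c + ∑ m ∈ Finset.Ico a b, H m d
      + ∑ n ∈ Finset.Ico c d, V a n + ∑ n ∈ Finset.Ico c d, V b n = 0 := by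
  obtain ⟨R, rfl⟩ := Int.le.dest hab
  obtain ⟨S, rfl⟩ := Int.le.dest hcd
  have h1 : ∑ m ∈ Finset.Ico a (a + R), ∑ n ∈ Finset.Ico c (c + S),
      ((H m n + H m (n + 1)) + (V m n + V (m + 1) n)) = 0 := by
    apply Finset.sum_eq_zero; intro m hm; apply Finset.sum_eq_zero; intro n hn
    simp at hm hn
    have := hsq m n hm.1 hm.2 hn.1 hn.2
    linear_combination this
  simp_rw [Finset.sum_add_distrib (f := fun n => H _ n + H _ (n + 1)), strip_sum] at h1
  rw [Finset.sum_add_distrib, Finset.sum_comm (f := fun m n => V m n + V (m + 1) n)] at h1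
  have : ∀ n, ∑ m ∈ Finset.Ico a (a + R), (V m n + V (m + 1) n) = V a n + V (a + R) n :=
    fun n => strip_sum (fun m => V m n) a R
  simp_rw [this, Finset.sum_add_distrib] at h1
  linear_combination h1

/-- the sparse lines -/
def LL (w p x0 : ℤ) (K : ℕ) : Finset ℤ :=
  (Finset.Ioo x0 (x0 + w)).filter (fun l => (sm w (4 * p * l)).natAbs ≤ 2 * K)

lemma sm_zero {w p : ℤ} (hw : 0 < w) (M : ℤ) : sm w (4 * p * (w * M)) = 0 :=
  sm_unique hw _ (2 * p * M) 0 (by ring) (by omega) hw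

lemma sm_inj {w p : ℤ} (hcop : IsCoprime (2 * p) w) {c d : ℤ}
    (h : sm w (4 * p * c) = sm w (4 * p * d)) : w ∣ c - d := by
  obtain ⟨t, ht⟩ := sm_congr_dvd h
  have : w ∣ 2 * p * (c - d) := ⟨t, by linarith⟩
  exact hcop.symm.dvd_of_dvd_mul_left this

lemma dvd_small {w z : ℤ} (h : w ∣ z) (h1 : -w < z) (h2 : z < w) : z = 0 := by
  have := Int.eq_zero_of_abs_lt_dvd h (abs_lt.mpr ⟨h1, h2⟩)
  exact this

lemma sum_nonzero (K : ℕ) : ((Finset.Icc (-(K : ℤ)) K).erase 0).card = 2 * K ∧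
    ∑ j ∈ (Finset.Icc (-(K : ℤ)) K).erase 0, (2 * j).natAbs = 2 * K * (K + 1) := by
  induction K with
  | zero => simp
  | succ K ih =>
    have : (Finset.Icc (-((K + 1 : ℕ) : ℤ)) ((K + 1 : ℕ) : ℤ)).erase 0 =
        insert (-((K : ℤ) + 1)) (insert ((K : ℤ) + 1) ((Finset.Icc (-(K : ℤ)) K).erase 0)) := by
      ext k; simp; omega
    rw [this]
    have n1 : ((K : ℤ) + 1) ∉ ((Finset.Icc (-(K : ℤ)) K).erase 0) := by simp
    have n2 : (-((K : ℤ) + 1)) ∉ insert ((K : ℤ) + 1) ((Finset.Icc (-(K : ℤ)) K).erase 0) := by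
      simp; omega
    rw [Finset.card_insert_of_notMem n2, Finset.card_insert_of_notMem n1,
      Finset.sum_insert n2, Finset.sum_insert n1, ih.1, ih.2]
    refine ⟨by ring, ?_⟩
    have e1 : (2 * (-((K : ℤ) + 1))).natAbs = 2 * (K + 1) := by omega
    have e2 : (2 * ((K : ℤ) + 1)).natAbs = 2 * (K + 1) := by omega
    rw [e1, e2]; ring

lemma LL_facts {w p : ℤ} (hw : 0 < w) (hcop : IsCoprime (2 * p) w) (M : ℤ) (K : ℕ)
    (hK : 2 * (K : ℤ) < w) :
    (LL w p (w * M) K).card = 2 * K ∧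
      ∑ l ∈ LL w p (w * M) K, (sm w (4 * p * l)).natAbs = 2 * K * (K + 1) := by
  have himg : (LL w p (w * M) K).image (fun l => sm w (4 * p * l) / 2)
      = (Finset.Icc (-(K : ℤ)) K).erase 0 := by
    ext j
    simp only [LL, Finset.mem_image, Finset.mem_filter, Finset.mem_Ioo, Finset.mem_erase,
      Finset.mem_Icc]
    constructor
    · rintro ⟨l, ⟨⟨h1, h2⟩, h3⟩, rfl⟩
      have hev := sm_even w p l
      have : sm w (4 * p * l) ≠ 0 := by
        intro h0
        have h := sm_inj hcop (h0.trans (sm_zero hw M).symm)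
        have := dvd_small h (by omega) (by omega)
        omega
      omega
    · rintro ⟨hj, h1, h2⟩
      obtain ⟨u, v, huv⟩ := hcop
      set l := w * M + (u * j) % w with hl
      have hmod := Int.emod_add_mul_ediv (u * j) w
      have hsm : sm w (4 * p * l) = 2 * j := by
        apply sm_unique hw _ (2 * p * M - v * j - 2 * p * ((u * j) / w)) _ ?_ (by omega) (by omega)
        rw [hl]
        linear_combination (-4 * p) * hmod.symm + 2 * j * huv
      have hb1 := Int.emod_nonneg (u * j) hw.ne'
      have hb2 := Int.emod_lt_of_pos (u * j) hw
      refine ⟨l, ⟨⟨?_, by omega⟩, by omega⟩, by omega⟩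
      rcases hb1.lt_or_eq with h | h
      · omega
      · exfalso
        have : l = w * M := by omega
        rw [this, sm_zero hw] at hsm
        omega
  have hinj : Set.InjOn (fun l => sm w (4 * p * l) / 2) (LL w p (w * M) K) := by
    intro a ha b hb hab
    simp only [LL, Finset.coe_filter, Set.mem_ofPred_eq, Finset.mem_Ioo] at ha hb hab
    have h1 := sm_even w p a
    have h2 := sm_even w p b
    have := dvd_small (sm_inj (c := a) (d := b) hcop (by omega)) (by omega) (by omega)
    omega
  refine ⟨?_, ?_⟩
  · rw [← Finset.card_image_of_injOn hinj, himg, (sum_nonzero K).1]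
  · rw [← (sum_nonzero K).2, ← himg, Finset.sum_image hinj]
    apply Finset.sum_congr rfl
    intro l _
    have := sm_even w p l
    congr 1; omega

/-! ### The empty cell -/

def gh (w p m n : ℤ) : ℕ := if hc w p m n = 1 then 1 else 0
def gv (w p m n : ℤ) : ℕ := if vc w p m n = 1 then 1 else 0

lemma gh_le (w p m n : ℤ) : gh w p m n ≤ hc w p m n := by
  unfold gh; split_ifs with h <;> omega

lemma gv_le (w p m n : ℤ) : gv w p m n ≤ vc w p m n := by
  unfold gv; split_ifs with h <;> omega

lemma ind_cast {k : ℕ} (h : k ≤ 2) : (((if k = 1 then 1 else 0 : ℕ)) : ZMod 2) = (k : ZMod 2) := by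
  interval_cases k <;> simp <;> rfl

lemma good_parity {w p : ℤ} (hp : 0 < p) (hpw : 2 * p < w) (hodd : w % 2 = 1) (m n : ℤ) :
    (gh w p m n : ZMod 2) + gh w p m (n + 1) + gv w p m n + gv w p (m + 1) n = 0 := by
  unfold gh gv
  rw [ind_cast (hc_le hp hpw m n), ind_cast (hc_le hp hpw m (n + 1)), ind_cast (vc_le w p m n),
    ind_cast (vc_le w p (m + 1) n)]
  exact square_parity hp hpw hodd m n

lemma zero_cell {w p : ℤ} (hp : 0 < p) (hpw : 2 * p < w) (hodd : w % 2 = 1)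
    (hcop : IsCoprime (2 * p) w) (M J : ℤ) (K : ℕ) (hK : 2 * (K : ℤ) < w) :
    ∃ a b c d : ℤ, w * M ≤ a ∧ a < b ∧ b ≤ w * M + w ∧ w * J ≤ c ∧ c < d ∧ d ≤ w * J + w ∧
      (∀ n, c ≤ n → n < d → vc w p a n ≠ 1 ∧ vc w p b n ≠ 1) ∧
      (∀ m, a ≤ m → m < b → hc w p m c ≠ 1 ∧ hc w p m d ≠ 1) ∧
      (∀ l, a < l → l < b → 2 * K < (sm w (4 * p * l)).natAbs) ∧
      (sm w (4 * p * a)).natAbs ≤ 2 * K ∧ (sm w (4 * p * b)).natAbs ≤ 2 * K ∧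
      (sm w (4 * p * c)).natAbs ≤ 2 * K ∧ (sm w (4 * p * d)).natAbs ≤ 2 * K := by
  have hw : 0 < w := by omega
  have hz1 : ∀ M : ℤ, sm w (4 * p * (w * M + w)) = 0 := fun M => by
    have := sm_zero (p := p) hw (M + 1)
    rwa [mul_add, mul_one] at this
  obtain ⟨cardX, sumX⟩ := LL_facts hw hcop M K hK
  obtain ⟨cardY, sumY⟩ := LL_facts hw hcop J K hK
  have hmem : ∀ M l : ℤ, l ∈ LL w p (w * M) K ↔ (w * M < l ∧ l < w * M + w) ∧
    (sm w (4 * p * l)).natAbs ≤ 2 * K := fun M l => by simp [LL]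
  obtain ⟨x, x0, x1, xlt, xno, xmem, xsum⟩ := sorted_seq (w * M) (LL w p (w * M) K) (w * M + w)
    (fun l hl => ((hmem M l).mp hl).1) (by omega)
  obtain ⟨y, y0, y1, ylt, yno, ymem, ysum⟩ := sorted_seq (w * J) (LL w p (w * J) K) (w * J + w)
    (fun l hl => ((hmem J l).mp hl).1) (by omega)
  rw [cardX] at x1 xlt xno xmem xsum
  rw [cardY] at y1 ylt yno ymem ysum
  set r := 2 * K + 1 with hr
  -- line sums
  set A : ℤ → ℕ := fun l => ∑ n ∈ Finset.Ico (w * J) (w * J + w), gv w p l n with hA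
  set B : ℤ → ℕ := fun l => ∑ m ∈ Finset.Ico (w * M) (w * M + w), gh w p m l with hB
  have hA' : ∀ l, A l ≤ (sm w (4 * p * l)).natAbs := fun l =>
    (Finset.sum_le_sum fun n _ => gv_le w p l n).trans (vc_total hw hodd hcop l (w * J))
  have hB' : ∀ l, B l ≤ (sm w (4 * p * l)).natAbs := fun l =>
    (Finset.sum_le_sum fun n _ => gh_le w p n l).trans (hc_total hp hpw hodd hcop M l)
  have tele : ∀ (z : ℕ → ℤ) (N : ℤ), z 0 = w * N → z r = w * N + w →
      (∀ i < r, z i < z (i + 1)) → ∀ φ : ℤ → ℕ,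
      ∑ i ∈ Finset.range r, ∑ k ∈ Finset.Ico (z i) (z (i + 1)), φ k
        = ∑ k ∈ Finset.Ico (w * N) (w * N + w), φ k := by
    intro z N h0 h1 h2 φ
    have := (sum_Ico_telescope z r (fun i hi => (h2 i hi).le) φ).1
    rw [h0, h1] at this; exact this
  have tot : ∀ (z : ℕ → ℤ) (N : ℤ) (φ : ℤ → ℕ), z 0 = w * N → z r = w * N + w →
      (∑ i ∈ Finset.range (2 * K), φ (z (i + 1)) = ∑ l ∈ LL w p (w * N) K, φ l) →
      (∑ l ∈ LL w p (w * N) K, (sm w (4 * p * l)).natAbs = 2 * K * (K + 1)) →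
      (∀ l, φ l ≤ (sm w (4 * p * l)).natAbs) →
      ∑ i ∈ Finset.range r, (φ (z i) + φ (z (i + 1))) ≤ 4 * K * (K + 1) := by
    intro z N φ h0 h1 h2 h3 h4
    rw [Finset.sum_add_distrib, hr, Finset.sum_range_succ', Finset.sum_range_succ (fun i => φ (z (i + 1))),
      h2]
    have e0 : φ (z 0) = 0 := by
      have := h4 (z 0); rw [h0, sm_zero hw] at this; rw [h0]; simpa using this
    have e1 : φ (z (2 * K + 1)) = 0 := by
      have := h4 (z r); rw [h1, hz1] at this; rw [← hr, h1]; simpa using this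
    have := Finset.sum_le_sum (s := LL w p (w * N) K) fun l _ => h4 l
    rw [h3] at this
    rw [e0, e1]; nlinarith
  have totA := tot x M A x0 x1 (xsum A) sumX hA'
  have totB := tot y J B y0 y1 (ysum B) sumY hB'
  set bc : ℕ → ℕ → ℕ := fun i j =>
    (∑ n ∈ Finset.Ico (y j) (y (j + 1)), gv w p (x i) n +
      ∑ n ∈ Finset.Ico (y j) (y (j + 1)), gv w p (x (i + 1)) n) +
    (∑ m ∈ Finset.Ico (x i) (x (i + 1)), gh w p m (y j) +
      ∑ m ∈ Finset.Ico (x i) (x (i + 1)), gh w p m (y (j + 1))) with hbc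
  have hsum : ∑ i ∈ Finset.range r, ∑ j ∈ Finset.range r, bc i j ≤ 8 * K * (K + 1) := by
    simp only [hbc]
    simp_rw [Finset.sum_add_distrib (s := Finset.range r), tele y J y0 y1 ylt]
    rw [Finset.sum_comm (f := fun i j => ∑ m ∈ Finset.Ico (x i) (x (i + 1)), gh w p m (y j)),
      Finset.sum_comm (f := fun i j => ∑ m ∈ Finset.Ico (x i) (x (i + 1)), gh w p m (y (j + 1)))]
    simp_rw [tele x M x0 x1 xlt]
    rw [Finset.sum_add_distrib] at totA totB
    simp only [hA, hB] at totA totB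
    linarith
  have hex : ∃ i < r, ∃ j < r, bc i j < 2 := by
    by_contra hcon
    push Not at hcon
    have : ∑ i ∈ Finset.range r, ∑ j ∈ Finset.range r, 2 ≤
        ∑ i ∈ Finset.range r, ∑ j ∈ Finset.range r, bc i j :=
      Finset.sum_le_sum fun i hi => Finset.sum_le_sum fun j hj =>
        hcon i (Finset.mem_range.mp hi) j (Finset.mem_range.mp hj)
    simp only [Finset.sum_const, Finset.card_range, smul_eq_mul] at this
    have h2 := this.trans hsum
    rw [hr] at h2
    nlinarith
  obtain ⟨i, hi, j, hj, hij⟩ := hex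
  have hpar : ((bc i j : ℕ) : ZMod 2) = 0 := by
    have := rect_parity (fun m n => (gh w p m n : ZMod 2)) (fun m n => (gv w p m n : ZMod 2))
      (x i) (x (i + 1)) (y j) (y (j + 1)) (xlt i hi).le (ylt j hj).le
      (fun m n _ _ _ _ => good_parity hp hpw hodd m n)
    simp only [hbc]
    push_cast
    linear_combination this
  have hbc0 : bc i j = 0 := by
    rw [ZMod.natCast_eq_zero_iff] at hpar
    omega
  have xs : ∀ i ≤ r, w * M ≤ x i ∧ x i ≤ w * M + w ∧ (sm w (4 * p * x i)).natAbs ≤ 2 * K := by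
    intro i hi
    rcases xmem i hi with h | h | h
    · have := (hmem M _).mp h; omega
    · rw [h, sm_zero hw]; simp; omega
    · rw [h, hz1]; simp; omega
  have ys : ∀ i ≤ r, w * J ≤ y i ∧ y i ≤ w * J + w ∧ (sm w (4 * p * y i)).natAbs ≤ 2 * K := by
    intro i hi
    rcases ymem i hi with h | h | h
    · have := (hmem J _).mp h; omega
    · rw [h, sm_zero hw]; simp; omega
    · rw [h, hz1]; simp; omega
  simp only [hbc, Nat.add_eq_zero_iff, Finset.sum_eq_zero_iff, Finset.mem_Ico] at hbc0
  obtain ⟨⟨b1, b2⟩, b3, b4⟩ := hbc0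
  have gvz : ∀ m n, gv w p m n = 0 → vc w p m n ≠ 1 := by
    intro m n h h'; simp [gv, h'] at h
  have ghz : ∀ m n, gh w p m n = 0 → hc w p m n ≠ 1 := by
    intro m n h h'; simp [gh, h'] at h
  refine ⟨x i, x (i + 1), y j, y (j + 1), (xs i hi.le).1, xlt i hi, (xs (i + 1) hi).2.1,
    (ys j hj.le).1, ylt j hj, (ys (j + 1) hj).2.1, ?_, ?_, ?_, (xs i hi.le).2.2,
    (xs (i + 1) hi).2.2, (ys j hj.le).2.2, (ys (j + 1) hj).2.2⟩
  · intro n h1 h2; exact ⟨gvz _ _ (b1 n ⟨h1, h2⟩), gvz _ _ (b2 n ⟨h1, h2⟩)⟩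
  · intro n h1 h2; exact ⟨ghz _ _ (b3 n ⟨h1, h2⟩), ghz _ _ (b4 n ⟨h1, h2⟩)⟩
  · intro l h1 h2
    by_contra hcon
    refine xno i hi l ((hmem M l).mpr ⟨⟨?_, ?_⟩, by omega⟩) ⟨h1, h2⟩
    · have := (xs i hi.le).1; omega
    · have := (xs (i + 1) hi).2.1; omega

/-! ### From the real definitions to integer counts -/

lemma nrm_eq {w : ℤ} (hw : 0 < w) (z : ℤ) (x : ℝ) (h : x = z / w) : nrm x = (sm w z : ℝ) / w := by
  have hwR : (0 : ℝ) < w := by exact_mod_cast hw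
  unfold nrm sm
  have : ⌊(x + 1) / 2⌋ = (z + w) / (2 * w) := by
    rw [Int.floor_eq_iff]
    have e : (x + 1) / 2 = ((z + w : ℤ) : ℝ) / ((2 * w : ℤ) : ℝ) := by
      rw [h]; push_cast; field_simp
    have h1 := Int.emod_add_mul_ediv (z + w) (2 * w)
    have h2 := Int.emod_nonneg (z + w) (show 2 * w ≠ 0 by omega)
    have h3 := Int.emod_lt_of_pos (z + w) (show 0 < 2 * w by omega)
    have hpos : (0 : ℝ) < ((2 * w : ℤ) : ℝ) := by exact_mod_cast (by omega : 0 < 2 * w)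
    rw [e, le_div_iff₀ hpos, div_lt_iff₀ hpos]
    constructor
    · have : (z + w) / (2 * w) * (2 * w) ≤ z + w := by linarith
      exact_mod_cast this
    · have : z + w < ((z + w) / (2 * w) + 1) * (2 * w) := by linarith
      exact_mod_cast this
  rw [this, h]; push_cast; field_simp

lemma lightPair_iff {w : ℤ} (hw : 0 < w) (a b : ℤ) :
    lightPair ((sm w a : ℝ) / w) ((sm w b : ℝ) / w) ↔ LI w a b := by
  have hwR : (0 : ℝ) < w := by exact_mod_cast hw
  unfold lightPair LI
  rw [abs_div, abs_div, abs_of_pos hwR, div_lt_div_iff_of_pos_right hwR, div_mul_div_comm, gt_iff_lt,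
    div_pos_iff_of_pos_right (by positivity)]
  norm_cast

lemma ncard_eq_sum (S : Set ℝ) (f : ℤ → ℝ) (hf : Function.Injective f) (T : Finset ℤ)
    (R : ℤ → Prop) (h : ∀ y, y ∈ S ↔ ∃ k ∈ T, R k ∧ y = f k) :
    S.ncard = ∑ k ∈ T, if R k then 1 else 0 := by
  have : S = f '' ((T.filter R : Finset ℤ) : Set ℤ) := by
    ext y; rw [h]; simp only [Set.mem_image, Finset.coe_filter, Set.mem_ofPred_eq]
    constructor
    · rintro ⟨k, h1, h2, h3⟩; exact ⟨k, ⟨h1, h2⟩, h3.symm⟩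
    · rintro ⟨k, ⟨h1, h2⟩, h3⟩; exact ⟨k, h1, h2, h3.symm⟩
  rw [this, Set.ncard_image_of_injective _ hf, Set.ncard_coe_finset, Finset.card_filter]

namespace Param

variable (π : Param)

lemma ww_pos : (0 : ℤ) < (π.ω : ℤ) := by
  have := π.p_pos; simp only [ω]; omega

lemma pp_pos : (0 : ℤ) < (π.p : ℤ) := by exact_mod_cast π.p_pos

lemma pp_lt : 2 * (π.p : ℤ) < (π.ω : ℤ) := by
  have := π.p_lt_q; simp only [ω]; omega

lemma ww_odd : (π.ω : ℤ) % 2 = 1 := by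
  have h1 := π.even_pq
  have h2 := π.coprime
  have h3 : ¬ (Even π.p ∧ Even π.q) := by
    rintro ⟨ha, hb⟩
    have := Nat.dvd_gcd ha.two_dvd hb.two_dvd
    rw [h2] at this; omega
  rw [Nat.even_mul] at h1
  simp only [Nat.even_iff] at h1 h3
  simp only [ω]; omega

lemma cop_p : IsCoprime (2 * (π.p : ℤ)) (π.ω : ℤ) := by
  apply IsCoprime.mul_left
  · rw [Int.isCoprime_iff_gcd_eq_one]
    have := π.ww_odd
    rw [← Int.isCoprime_iff_gcd_eq_one]
    exact ⟨-((π.ω : ℤ) / 2), 1, by omega⟩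
  · simp only [ω]; push_cast
    have : IsCoprime (π.p : ℤ) (π.q : ℤ) := Nat.isCoprime_iff_coprime.mpr π.coprime
    obtain ⟨u, v, h⟩ := this
    exact ⟨u - v, v, by linear_combination h⟩

lemma cop_q : IsCoprime (2 * (π.q : ℤ)) (π.ω : ℤ) := by
  apply IsCoprime.mul_left
  · have := π.ww_odd
    exact ⟨-((π.ω : ℤ) / 2), 1, by omega⟩
  · simp only [ω]; push_cast
    have : IsCoprime (π.p : ℤ) (π.q : ℤ) := Nat.isCoprime_iff_coprime.mpr π.coprime
    obtain ⟨u, v, h⟩ := this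
    exact ⟨v - u, u, by linear_combination h⟩

lemma wR_pos : (0 : ℝ) < ((π.ω : ℤ) : ℝ) := by exact_mod_cast π.ww_pos

lemma P_eq : π.P = 2 * ((π.p : ℤ) : ℝ) / ((π.ω : ℤ) : ℝ) := by unfold P; push_cast; rfl
lemma Q_eq : π.Q = 2 * ((π.q : ℤ) : ℝ) / ((π.ω : ℤ) : ℝ) := by unfold Q; push_cast; rfl
lemma PQ_add : π.P + π.Q = 2 := by
  have := π.wR_pos
  rw [P_eq, Q_eq]; field_simp; simp only [ω]; push_cast; ring
lemma P_pos : 0 < π.P := by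
  have := π.wR_pos
  have h : (0 : ℝ) < ((π.p : ℤ) : ℝ) := by exact_mod_cast π.pp_pos
  rw [P_eq]; positivity
lemma P_lt_one : π.P < 1 := by
  have := π.wR_pos
  rw [P_eq, div_lt_one this]; exact_mod_cast π.pp_lt
lemma Q_pos : 0 < π.Q := by have := π.PQ_add; have := π.P_lt_one; linarith

lemma nrm_line (l : ℤ) : nrm (2 * π.P * l) = (sm π.ω (4 * π.p * l) : ℝ) / ((π.ω : ℤ) : ℝ) := by
  apply nrm_eq π.ww_pos
  rw [P_eq]; push_cast; ring

lemma nrm_obl (c : ℤ) : nrm (π.P * c + 1) = (sm π.ω (2 * π.p * c + π.ω) : ℝ) / ((π.ω : ℤ) : ℝ) := by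
  apply nrm_eq π.ww_pos
  have := π.wR_pos
  rw [P_eq]; push_cast; push_cast at this; field_simp

lemma light_iff (l c : ℤ) : lightPair (nrm (2 * π.P * l)) (nrm (π.P * c + 1)) ↔
    Lt π.ω π.p l c := by
  rw [nrm_line, nrm_obl, lightPair_iff π.ww_pos]; rfl

lemma lightVP_iff (m : ℤ) (y : ℝ) : π.lightVP ((m : ℝ), y) ↔
    ∃ c : ℤ, Lt π.ω π.p m c ∧ y = c - π.P * m := by
  unfold lightVP onV onP FV FP
  simp only
  constructor
  · rintro ⟨_, ⟨c, hc⟩, h⟩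
    refine ⟨c, ?_, by linarith⟩
    rw [← light_iff]
    convert h using 2
    rw [← hc]; ring
  · rintro ⟨c, h, rfl⟩
    refine ⟨⟨m, rfl⟩, ⟨c, by ring⟩, ?_⟩
    rw [← light_iff] at h
    convert h using 2
    ring

lemma lightVQ_iff (m : ℤ) (y : ℝ) : π.lightVQ ((m : ℝ), y) ↔
    ∃ c : ℤ, Lt π.ω π.p m c ∧ y = c - π.Q * m := by
  unfold lightVQ onV onQ FV FQ
  simp only
  constructor
  · rintro ⟨_, ⟨c, hc⟩, h⟩
    refine ⟨c, ?_, by linarith⟩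
    rw [← light_iff]
    convert h using 2
    rw [← hc]; ring
  · rintro ⟨c, h, rfl⟩
    refine ⟨⟨m, rfl⟩, ⟨c, by ring⟩, ?_⟩
    rw [← light_iff] at h
    convert h using 2
    ring

lemma lightHP_iff (n : ℤ) (x : ℝ) : π.lightHP (x, (n : ℝ)) ↔
    ∃ k : ℤ, Lt π.ω π.p n (n + k) ∧ x = k / π.P := by
  have hP := π.P_pos.ne'
  unfold lightHP onH onP FH FP
  simp only
  constructor
  · rintro ⟨_, ⟨c, hc⟩, h⟩
    refine ⟨c - n, ?_, ?_⟩
    · rw [← light_iff]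
      convert h using 2
      push_cast; rw [← hc]; ring
    · push_cast; rw [← hc]; field_simp; ring
  · rintro ⟨k, h, rfl⟩
    refine ⟨⟨n, rfl⟩, ⟨n + k, by push_cast; field_simp⟩, ?_⟩
    rw [← light_iff] at h
    convert h using 2
    push_cast; field_simp

lemma lightHQ_iff (n : ℤ) (x : ℝ) : π.lightHQ (x, (n : ℝ)) ↔
    ∃ k : ℤ, Lt π.ω π.p n (n + k) ∧ x = k / π.Q := by
  have hQ := π.Q_pos.ne'
  unfold lightHQ onH onQ FH FQ
  simp only
  constructor
  · rintro ⟨_, ⟨c, hc⟩, h⟩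
    refine ⟨c - n, ?_, ?_⟩
    · rw [← light_iff]
      convert h using 2
      push_cast; rw [← hc]; ring
    · push_cast; rw [← hc]; field_simp; ring
  · rintro ⟨k, h, rfl⟩
    refine ⟨⟨n, rfl⟩, ⟨n + k, by push_cast; field_simp⟩, ?_⟩
    rw [← light_iff] at h
    convert h using 2
    push_cast; field_simp

lemma vLightCount_eq (m n : ℤ) : π.vLightCount m n = vc π.ω π.p m n := by
  have hw := π.ww_pos
  have hwR := π.wR_pos
  have hP := π.P_eq
  have hPQ := π.PQ_add
  have hfl := fl_bounds hw π.p m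
  by_cases hdvd : (π.ω : ℤ) ∣ m
  · obtain ⟨M, rfl⟩ := hdvd
    have hno : ∀ c, ¬ Lt π.ω π.p (π.ω * M) c := by
      intro c h
      unfold Lt at h
      rw [LI_iff, sm_zero hw] at h; omega
    unfold vLightCount vc el
    simp only [lightVP_iff, lightVQ_iff]
    simp [hno]
  · have hne : fl π.ω π.p m * π.ω ≠ 2 * π.p * m := by
      intro h
      apply hdvd
      exact π.cop_p.symm.dvd_of_dvd_mul_left ⟨fl π.ω π.p m, by rw [← h]; ring⟩
    have hb1 : (fl π.ω π.p m : ℝ) < π.P * m := by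
      rw [hP, div_mul_eq_mul_div, lt_div_iff₀ hwR]
      have : fl π.ω π.p m * π.ω < 2 * π.p * m := lt_of_le_of_ne (by linarith [hfl.1]) hne
      exact_mod_cast this
    have hb2 : π.P * m < (fl π.ω π.p m : ℝ) + 1 := by
      rw [hP, div_mul_eq_mul_div, div_lt_iff₀ hwR]
      have : 2 * π.p * m < (fl π.ω π.p m + 1) * π.ω := by linarith [hfl.2]
      exact_mod_cast this
    unfold vLightCount vc el
    congr 1
    · rw [ncard_eq_sum _ (fun c => (c : ℝ) - π.P * m) (fun a b h => by simpa using h)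
        {n + fl π.ω π.p m + 1} (fun c => Lt π.ω π.p m c)]
      · rw [Finset.sum_singleton]
      · intro y
        simp only [Set.mem_ofPred_eq, lightVP_iff, Set.mem_Icc, Finset.mem_singleton]
        constructor
        · rintro ⟨⟨h1, h2⟩, c, h3, rfl⟩
          refine ⟨c, ?_, h3, rfl⟩
          have h4 : n + fl π.ω π.p m < c := by
            have : ((n + fl π.ω π.p m : ℤ) : ℝ) < c := by push_cast; linarith
            exact_mod_cast this
          have h5 : c < n + fl π.ω π.p m + 2 := by
            have : (c : ℝ) < ((n + fl π.ω π.p m + 2 : ℤ) : ℝ) := by push_cast; linarith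
            exact_mod_cast this
          omega
        · rintro ⟨c, rfl, h3, rfl⟩
          refine ⟨⟨?_, ?_⟩, _, h3, rfl⟩ <;> push_cast <;> linarith
    · rw [ncard_eq_sum _ (fun c => (c : ℝ) - π.Q * m) (fun a b h => by simpa using h)
        {n + 2 * m - fl π.ω π.p m} (fun c => Lt π.ω π.p m c)]
      · rw [Finset.sum_singleton]
      · have hQ : π.Q = 2 - π.P := by linarith
        intro y
        simp only [Set.mem_ofPred_eq, lightVQ_iff, Set.mem_Icc, Finset.mem_singleton]
        constructor
        · rintro ⟨⟨h1, h2⟩, c, h3, rfl⟩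
          refine ⟨c, ?_, h3, rfl⟩
          rw [hQ] at h1 h2
          have h4 : n + 2 * m - fl π.ω π.p m - 1 < c := by
            have : ((n + 2 * m - fl π.ω π.p m - 1 : ℤ) : ℝ) < c := by push_cast; linarith
            exact_mod_cast this
          have h5 : c < n + 2 * m - fl π.ω π.p m + 1 := by
            have : (c : ℝ) < ((n + 2 * m - fl π.ω π.p m + 1 : ℤ) : ℝ) := by push_cast; linarith
            exact_mod_cast this
          omega
        · rintro ⟨c, rfl, h3, rfl⟩
          rw [hQ]
          refine ⟨⟨?_, ?_⟩, _, h3, rfl⟩ <;> push_cast <;> linarith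

end Param

namespace Param

variable (π : Param)

lemma Pk_icc (m k : ℤ) : ((k : ℝ) / π.P ∈ Set.Icc (m : ℝ) ((m : ℝ) + 1)) ↔
    2 * π.p * m ≤ k * π.ω ∧ k * π.ω ≤ 2 * π.p * (m + 1) := by
  have hwR := π.wR_pos
  have hP := π.P_pos
  rw [Set.mem_Icc, le_div_iff₀ hP, div_le_iff₀ hP, P_eq, mul_div_assoc', mul_div_assoc',
    div_le_iff₀ hwR, le_div_iff₀ hwR]
  have e1 : ((m : ℝ) * (2 * ((π.p : ℤ) : ℝ)) ≤ k * ((π.ω : ℤ) : ℝ)) ↔ 2 * π.p * m ≤ k * π.ω := by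
    rw [show 2 * (π.p : ℤ) * m = m * (2 * π.p) by ring]; exact_mod_cast Iff.rfl
  have e2 : ((k : ℝ) * ((π.ω : ℤ) : ℝ) ≤ ((m : ℝ) + 1) * (2 * ((π.p : ℤ) : ℝ))) ↔
      k * π.ω ≤ 2 * π.p * (m + 1) := by
    rw [show 2 * (π.p : ℤ) * (m + 1) = (m + 1) * (2 * π.p) by ring]; exact_mod_cast Iff.rfl
  rw [e1, e2]

lemma Qk_icc (m k : ℤ) : ((k : ℝ) / π.Q ∈ Set.Icc (m : ℝ) ((m : ℝ) + 1)) ↔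
    2 * π.q * m ≤ k * π.ω ∧ k * π.ω ≤ 2 * π.q * (m + 1) := by
  have hwR := π.wR_pos
  have hP := π.Q_pos
  rw [Set.mem_Icc, le_div_iff₀ hP, div_le_iff₀ hP, Q_eq, mul_div_assoc', mul_div_assoc',
    div_le_iff₀ hwR, le_div_iff₀ hwR]
  have e1 : ((m : ℝ) * (2 * ((π.q : ℤ) : ℝ)) ≤ k * ((π.ω : ℤ) : ℝ)) ↔ 2 * π.q * m ≤ k * π.ω := by
    rw [show 2 * (π.q : ℤ) * m = m * (2 * π.q) by ring]; exact_mod_cast Iff.rfl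
  have e2 : ((k : ℝ) * ((π.ω : ℤ) : ℝ) ≤ ((m : ℝ) + 1) * (2 * ((π.q : ℤ) : ℝ))) ↔
      k * π.ω ≤ 2 * π.q * (m + 1) := by
    rw [show 2 * (π.q : ℤ) * (m + 1) = (m + 1) * (2 * π.q) by ring]; exact_mod_cast Iff.rfl
  rw [e1, e2]

lemma q_pos' : (0 : ℤ) < (π.q : ℤ) := by have := π.p_lt_q; omega

lemma w_eq : (π.ω : ℤ) = π.p + π.q := by simp [ω]

/-- the `Q` points which are counted are the ones in the open segment -/
lemma Q_cond (m n k : ℤ) :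
    ((2 * π.q * m ≤ k * π.ω ∧ k * π.ω ≤ 2 * π.q * (m + 1)) ∧
      (π.onP ((k : ℝ) / π.Q, (n : ℝ)) → (k : ℝ) / π.Q = (m : ℝ) + 1 / 2)) ↔
    (2 * π.q * m < k * π.ω ∧ k * π.ω < 2 * π.q * (m + 1)) := by
  have hwR := π.wR_pos
  have hq := π.q_pos'
  have hqR : (0 : ℝ) < ((π.q : ℤ) : ℝ) := by exact_mod_cast hq
  have hQ := π.Q_pos
  have hxval : ∀ s : ℤ, k = 2 * π.q * s → (k : ℝ) / π.Q = ((π.ω * s : ℤ) : ℝ) := by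
    intro s hs
    rw [hs, Q_eq]; push_cast; push_cast at hwR hqR; field_simp
  have hval2 : ∀ s : ℤ, k = 2 * π.q * s → π.onP ((k : ℝ) / π.Q, (n : ℝ)) := by
    intro s hs
    refine ⟨n + 2 * π.p * s, ?_⟩
    simp only
    rw [hxval s hs, P_eq]; push_cast; push_cast at hwR; field_simp
  constructor
  · rintro ⟨⟨h1, h2⟩, h3⟩
    have key : ∀ l : ℤ, k * π.ω ≠ 2 * π.q * l := by
      intro l hl
      have : 2 * (π.q : ℤ) ∣ k := π.cop_q.dvd_of_dvd_mul_right ⟨l, hl⟩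
      obtain ⟨s, hs⟩ := this
      have h4 := h3 (hval2 s hs)
      rw [hxval s hs] at h4
      have h5 : (((2 * (π.ω * s) : ℤ)) : ℝ) = ((2 * m + 1 : ℤ) : ℝ) := by
        push_cast; push_cast at h4; linarith
      have h6 : 2 * ((π.ω : ℤ) * s) = 2 * m + 1 := by exact_mod_cast h5
      omega
    exact ⟨lt_of_le_of_ne h1 (key m).symm, lt_of_le_of_ne h2 (key (m + 1))⟩
  · rintro ⟨h1, h2⟩
    refine ⟨⟨h1.le, h2.le⟩, ?_⟩
    rintro ⟨c, hc⟩
    simp only at hc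
    have h3 : (π.p : ℤ) * k = (c - n) * π.q := by
      have : (((π.p : ℤ) * k : ℤ) : ℝ) = (((c - n) * π.q : ℤ) : ℝ) := by
        rw [P_eq, Q_eq] at hc
        field_simp at hc
        push_cast; push_cast at hc; linarith
      exact_mod_cast this
    have hcop : IsCoprime (π.p : ℤ) (π.q : ℤ) := Nat.isCoprime_iff_coprime.mpr π.coprime
    have : (π.q : ℤ) ∣ k := hcop.symm.dvd_of_dvd_mul_left ⟨c - n, by linarith⟩
    obtain ⟨t, ht⟩ := this
    have h4 : 2 * m < π.ω * t := by
      have : (π.q : ℤ) * (2 * m) < π.q * (π.ω * t) := by rw [ht] at h1; linarith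
      exact lt_of_mul_lt_mul_left this hq.le
    have h5 : π.ω * t < 2 * m + 2 := by
      have : (π.q : ℤ) * (π.ω * t) < π.q * (2 * m + 2) := by rw [ht] at h2; linarith
      exact lt_of_mul_lt_mul_left this hq.le
    have h6 : (π.ω : ℤ) * t = 2 * m + 1 := by omega
    have h7 : ((π.ω : ℤ) : ℝ) * t = 2 * m + 1 := by exact_mod_cast h6
    rw [ht, Q_eq]
    push_cast
    push_cast at h7 hqR hwR
    field_simp
    linarith

lemma hLightCount_eq (m n : ℤ) : π.hLightCount m n = hc π.ω π.p m n := by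
  have hw := π.ww_pos
  have hfl := fl_bounds hw π.p m
  have hfl1 := fl_bounds hw π.p (m + 1)
  have hst := fl_step π.pp_pos π.pp_lt m
  have hweq := π.w_eq
  have hPne := π.P_pos.ne'
  have hQne := π.Q_pos.ne'
  set w : ℤ := (π.ω : ℤ) with hwd
  set p : ℤ := (π.p : ℤ) with hpd
  set f0 := fl w p m with hf0
  set f1 := fl w p (m + 1) with hf1
  have injP : Function.Injective (fun k : ℤ => (k : ℝ) / π.P) := fun a b h => by
    have := (div_left_inj' hPne).mp h
    exact_mod_cast this
  have injQ : Function.Injective (fun k : ℤ => (k : ℝ) / π.Q) := fun a b h => by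
    have := (div_left_inj' hQne).mp h
    exact_mod_cast this
  have lin : ∀ k : ℤ, k * w ≤ 2 * p * (m + 1) ↔ k ≤ f1 := by
    intro k; constructor
    · intro h; by_contra hc; push Not at hc; nlinarith
    · intro h; nlinarith
  have lin0 : ∀ k : ℤ, k * w ≤ 2 * p * m ↔ k ≤ f0 := by
    intro k; constructor
    · intro h; by_contra hc; push Not at hc; nlinarith
    · intro h; nlinarith
  have q2 : 2 * (π.q : ℤ) = 2 * w - 2 * p := by omega
  have linq0 : ∀ k : ℤ, 2 * (π.q : ℤ) * m ≤ k * w ↔ 2 * m - 1 - f0 < k := by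
    intro k; rw [q2]
    have := lin0 (2 * m - k)
    constructor
    · intro h; have := this.mp (by linarith); omega
    · intro h; have := this.mpr (by omega); linarith
  have linq1 : ∀ k : ℤ, k * w < 2 * (π.q : ℤ) * (m + 1) ↔ k ≤ 2 * (m + 1) - 1 - f1 := by
    intro k; rw [q2]
    have := lin (2 * m + 2 - k)
    constructor
    · intro h; by_contra hc; have := this.mpr (by omega); linarith
    · intro h; by_contra hc; have := this.mp (by linarith); omega
  -- P and Q counts
  have cP : ∀ T : Finset ℤ, (∀ k, k ∈ T ↔ 2 * p * m ≤ k * w ∧ k * w ≤ 2 * p * (m + 1)) →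
      Set.ncard {x : ℝ | x ∈ Set.Icc (m : ℝ) ((m : ℝ) + 1) ∧ π.lightHP (x, (n : ℝ))}
        = ∑ k ∈ T, el w p n (n + k) := by
    intro T hT
    unfold el
    apply ncard_eq_sum _ _ injP
    intro y
    simp only [Set.mem_ofPred_eq, lightHP_iff]
    constructor
    · rintro ⟨h1, k, h2, rfl⟩; exact ⟨k, (hT k).mpr ((π.Pk_icc m k).mp h1), h2, rfl⟩
    · rintro ⟨k, h1, h2, rfl⟩; exact ⟨(π.Pk_icc m k).mpr ((hT k).mp h1), k, h2, rfl⟩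
  have cQ : ∀ T : Finset ℤ,
      (∀ k, k ∈ T ↔ 2 * (π.q : ℤ) * m < k * w ∧ k * w < 2 * (π.q : ℤ) * (m + 1)) →
      Set.ncard {x : ℝ | x ∈ Set.Icc (m : ℝ) ((m : ℝ) + 1) ∧ π.lightHQ (x, (n : ℝ)) ∧
        (π.onP (x, (n : ℝ)) → x = (m : ℝ) + 1 / 2)}
        = ∑ k ∈ T, el w p n (n + k) := by
    intro T hT
    unfold el
    apply ncard_eq_sum _ _ injQ
    intro y
    simp only [Set.mem_ofPred_eq, lightHQ_iff]
    constructor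
    · rintro ⟨h1, ⟨k, h2, rfl⟩, h3⟩
      exact ⟨k, (hT k).mpr ((π.Q_cond m n k).mp ⟨(π.Qk_icc m k).mp h1, h3⟩), h2, rfl⟩
    · rintro ⟨k, h1, h2, rfl⟩
      have := (π.Q_cond m n k).mpr ((hT k).mp h1)
      exact ⟨(π.Qk_icc m k).mpr this.1, ⟨k, h2, rfl⟩, this.2⟩
  unfold hLightCount hc
  by_cases hdvd : w ∣ m
  · obtain ⟨M, hM⟩ := hdvd
    have hf0' : f0 = 2 * p * M := by rw [hf0, hM]; exact fl_mul hw p M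
    have lin0' : ∀ k : ℤ, 2 * p * m ≤ k * w ↔ f0 ≤ k := by
      intro k
      have : 2 * p * m = f0 * w := by rw [hf0', hM]; ring
      rw [this]; exact mul_le_mul_iff_left₀ hw
    have linq0' : ∀ k : ℤ, 2 * (π.q : ℤ) * m < k * w ↔ 2 * m - f0 < k := by
      intro k; rw [q2]
      have : (2 * w - 2 * p) * m = (2 * m - f0) * w := by rw [hf0', hM]; ring
      rw [this]; exact mul_lt_mul_iff_left₀ hw
    rw [cP (insert f0 (Finset.Ioc f0 f1)) (fun k => by
        rw [lin, lin0', Finset.mem_insert, Finset.mem_Ioc]; omega),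
      cQ (Finset.Ioc (2 * m - f0) (2 * (m + 1) - 1 - f1)) (fun k => by
        rw [linq1, linq0', Finset.mem_Ioc]),
      Finset.sum_insert (by simp)]
    have hsplit : Finset.Ioc (2 * m - 1 - f0) (2 * (m + 1) - 1 - f1)
        = insert (2 * m - f0) (Finset.Ioc (2 * m - f0) (2 * (m + 1) - 1 - f1)) := by
      ext k; simp only [Finset.mem_insert, Finset.mem_Ioc]
      omega
    rw [hsplit, Finset.sum_insert (by simp)]
    have hel : el w p n (n + f0) = el w p n (n + (2 * m - f0)) := by
      rw [← el_reflect hw π.ww_odd p n (n + f0), ← el_period hw p n _ (2 * M)]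
      congr 1
      rw [hM]; ring
    rw [hel]; ring
  · have hne : 2 * p * m ≠ f0 * w := by
      intro h
      exact hdvd (π.cop_p.symm.dvd_of_dvd_mul_left ⟨f0, by rw [h]; ring⟩)
    have lin0' : ∀ k : ℤ, 2 * p * m ≤ k * w ↔ f0 < k := by
      intro k
      have := lin0 k
      constructor
      · intro h
        by_contra hc
        have h1 := this.mpr (by omega)
        have h2 : k * w ≤ f0 * w := by nlinarith
        have h3 : f0 * w ≤ 2 * p * m := by linarith [hfl.1]
        exact hne (by linarith)
      · intro h
        by_contra hc
        have := this.mp (by omega)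
        omega
    have linq0' : ∀ k : ℤ, 2 * (π.q : ℤ) * m < k * w ↔ 2 * m - 1 - f0 < k := by
      intro k
      rw [← linq0 k]
      constructor
      · exact le_of_lt
      · intro h
        refine lt_of_le_of_ne h ?_
        intro h'
        apply hdvd
        exact π.cop_q.symm.dvd_of_dvd_mul_left ⟨k, by rw [h']; ring⟩
    rw [cP (Finset.Ioc f0 f1) (fun k => by rw [lin, lin0', Finset.mem_Ioc]),
      cQ (Finset.Ioc (2 * m - 1 - f0) (2 * (m + 1) - 1 - f1)) (fun k => by
        rw [linq1, linq0', Finset.mem_Ioc])]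

lemma goodH_iff (m n : ℤ) : π.goodH m n ↔ hc π.ω π.p m n = 1 := by
  unfold goodH; rw [hLightCount_eq]

lemma goodV_iff (m n : ℤ) : π.goodV m n ↔ vc π.ω π.p m n = 1 := by
  unfold goodV; rw [vLightCount_eq]

end Param

/-! ### Topology of the plaid set -/

namespace Param

variable (π : Param)

/-- dual segment of a horizontal edge -/
def dH (m n : ℤ) : Set (ℝ × ℝ) := {z | z.1 = m + 1 / 2 ∧ (n : ℝ) - 1 / 2 ≤ z.2 ∧ z.2 ≤ n + 1 / 2}
/-- dual segment of a vertical edge -/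
def dV (m n : ℤ) : Set (ℝ × ℝ) := {z | z.2 = n + 1 / 2 ∧ (m : ℝ) - 1 / 2 ≤ z.1 ∧ z.1 ≤ m + 1 / 2}

lemma mem_seg_vert (x y0 y1 : ℝ) (z : ℝ × ℝ) :
    z ∈ segment ℝ (x, y0) (x, y1) ↔ z.1 = x ∧ z.2 ∈ segment ℝ y0 y1 := by
  rw [← Prod.image_mk_segment_right]
  constructor
  · rintro ⟨y, hy, rfl⟩; exact ⟨rfl, hy⟩
  · rintro ⟨rfl, h⟩; exact ⟨z.2, h, rfl⟩

lemma mem_seg_hor (y x0 x1 : ℝ) (z : ℝ × ℝ) :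
    z ∈ segment ℝ (x0, y) (x1, y) ↔ z.2 = y ∧ z.1 ∈ segment ℝ x0 x1 := by
  rw [← Prod.image_mk_segment_left]
  constructor
  · rintro ⟨y, hy, rfl⟩; exact ⟨rfl, hy⟩
  · rintro ⟨rfl, h⟩; exact ⟨z.1, h, rfl⟩

lemma seg_up (a b : ℝ) (h : a ≤ b) (y : ℝ) : y ∈ segment ℝ a b ↔ a ≤ y ∧ y ≤ b := by
  rw [segment_eq_Icc h]; rfl

lemma seg_down (a b : ℝ) (h : b ≤ a) (y : ℝ) : y ∈ segment ℝ a b ↔ b ≤ y ∧ y ≤ a := by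
  rw [segment_symm, segment_eq_Icc h]; rfl

lemma plaid_iff (z : ℝ × ℝ) : z ∈ π.plaidSet ↔
    (∃ m n : ℤ, π.goodH m n ∧ z ∈ dH m n) ∨ (∃ m n : ℤ, π.goodV m n ∧ z ∈ dV m n) := by
  unfold plaidSet dH dV
  simp only [Set.mem_ofPred_eq, mem_seg_vert, mem_seg_hor]
  constructor
  · rintro ⟨m, n, ⟨h, h1, h2⟩ | ⟨h, h1, h2⟩ | ⟨h, h1, h2⟩ | ⟨h, h1, h2⟩⟩
    · rw [seg_down _ _ (by linarith)] at h2
      exact Or.inl ⟨m, n, h, h1, by linarith, by linarith⟩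
    · rw [seg_up _ _ (by linarith)] at h2
      exact Or.inl ⟨m, n + 1, h, h1, by push_cast; linarith, by push_cast; linarith⟩
    · rw [seg_down _ _ (by linarith)] at h2
      exact Or.inr ⟨m, n, h, h1, by linarith, by linarith⟩
    · rw [seg_up _ _ (by linarith)] at h2
      exact Or.inr ⟨m + 1, n, h, h1, by push_cast; linarith, by push_cast; linarith⟩
  · rintro (⟨m, n, h, h1, h2, h3⟩ | ⟨m, n, h, h1, h2, h3⟩)
    · rcases le_total z.2 n with hz | hz
      · refine ⟨m, n - 1, Or.inr (Or.inl ⟨by rwa [sub_add_cancel], h1, ?_⟩)⟩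
        rw [seg_up _ _ (by linarith)]
        push_cast; constructor <;> linarith
      · refine ⟨m, n, Or.inl ⟨h, h1, ?_⟩⟩
        rw [seg_down _ _ (by linarith)]
        constructor <;> linarith
    · rcases le_total z.1 m with hz | hz
      · refine ⟨m - 1, n, Or.inr (Or.inr (Or.inr ⟨by rwa [sub_add_cancel], h1, ?_⟩))⟩
        rw [seg_up _ _ (by linarith)]
        push_cast; constructor <;> linarith
      · refine ⟨m, n, Or.inr (Or.inr (Or.inl ⟨h, h1, ?_⟩))⟩
        rw [seg_down _ _ (by linarith)]
        constructor <;> linarith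

lemma dH_sub {m n : ℤ} (h : π.goodH m n) : dH m n ⊆ π.plaidSet :=
  fun z hz => (π.plaid_iff z).mpr (Or.inl ⟨m, n, h, hz⟩)

lemma dV_sub {m n : ℤ} (h : π.goodV m n) : dV m n ⊆ π.plaidSet :=
  fun z hz => (π.plaid_iff z).mpr (Or.inr ⟨m, n, h, hz⟩)

lemma dH_conn (m n : ℤ) : IsPreconnected (dH m n) := by
  have : dH m n = ({(m : ℝ) + 1 / 2} : Set ℝ) ×ˢ Set.Icc ((n : ℝ) - 1 / 2) (n + 1 / 2) := by
    ext z; simp [dH]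
  rw [this]; exact isPreconnected_singleton.prod isPreconnected_Icc

lemma dV_conn (m n : ℤ) : IsPreconnected (dV m n) := by
  have : dV m n = Set.Icc ((m : ℝ) - 1 / 2) (m + 1 / 2) ×ˢ ({(n : ℝ) + 1 / 2} : Set ℝ) := by
    ext z; simp [dV]; tauto
  rw [this]; exact isPreconnected_Icc.prod isPreconnected_singleton

lemma same_comp {D : Set (ℝ × ℝ)} (hD : IsPreconnected D) (hs : D ⊆ π.plaidSet) {u v z : ℝ × ℝ}
    (hu : u ∈ D) (hv : v ∈ D) (h : u ∈ connectedComponentIn π.plaidSet z) :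
    v ∈ connectedComponentIn π.plaidSet z := by
  rw [connectedComponentIn_eq h]
  exact hD.subset_connectedComponentIn hu hs hv

lemma plaid_y_int {z : ℝ × ℝ} (hz : z ∈ π.plaidSet) {n : ℤ} (h : z.2 = n) :
    ∃ m : ℤ, z.1 = m + 1 / 2 ∧ π.goodH m n := by
  rcases (π.plaid_iff z).mp hz with ⟨m, n', hg, h1, h2, h3⟩ | ⟨m, n', hg, h1, h2, h3⟩
  · rw [h] at h2 h3
    have e1 : (n' : ℝ) < ((n + 1 : ℤ) : ℝ) := by push_cast; linarith
    have e2 : (n : ℝ) < ((n' + 1 : ℤ) : ℝ) := by push_cast; linarith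
    have e1 : n' < n + 1 := by exact_mod_cast e1
    have e2 : n < n' + 1 := by exact_mod_cast e2
    have : n' = n := by omega
    subst this; exact ⟨m, h1, hg⟩
  · exfalso
    rw [h] at h1
    have : ((2 * n : ℤ) : ℝ) = ((2 * n' + 1 : ℤ) : ℝ) := by push_cast; linarith
    have : 2 * n = 2 * n' + 1 := by exact_mod_cast this
    omega

lemma plaid_x_int {z : ℝ × ℝ} (hz : z ∈ π.plaidSet) {m : ℤ} (h : z.1 = m) :
    ∃ n : ℤ, z.2 = n + 1 / 2 ∧ π.goodV m n := by
  rcases (π.plaid_iff z).mp hz with ⟨n', m', hg, h1, h2, h3⟩ | ⟨m', n', hg, h1, h2, h3⟩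
  · exfalso
    rw [h] at h1
    have : ((2 * m : ℤ) : ℝ) = ((2 * n' + 1 : ℤ) : ℝ) := by push_cast; linarith
    have : 2 * m = 2 * n' + 1 := by exact_mod_cast this
    omega
  · rw [h] at h2 h3
    have e1 : (m' : ℝ) < ((m + 1 : ℤ) : ℝ) := by push_cast; linarith
    have e2 : (m : ℝ) < ((m' + 1 : ℤ) : ℝ) := by push_cast; linarith
    have e1 : m' < m + 1 := by exact_mod_cast e1
    have e2 : m < m' + 1 := by exact_mod_cast e2
    have : m' = m := by omega
    subst this; exact ⟨n', h1, hg⟩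

lemma confine {a b c d : ℤ}
    (hV : ∀ n, c ≤ n → n < d → ¬ π.goodV a n ∧ ¬ π.goodV b n)
    (hH : ∀ m, a ≤ m → m < b → ¬ π.goodH m c ∧ ¬ π.goodH m d)
    {z : ℝ × ℝ} (hz : z ∈ π.plaidSet)
    (hzU : z ∈ Set.Ioo (a : ℝ) b ×ˢ Set.Ioo (c : ℝ) d) :
    connectedComponentIn π.plaidSet z ⊆ Set.Ioo (a : ℝ) b ×ˢ Set.Ioo (c : ℝ) d := by
  have half : ∀ {k l m : ℤ}, (k : ℝ) ≤ m + 1 / 2 → (m : ℝ) + 1 / 2 ≤ l → k ≤ m ∧ m < l := by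
    intro k l m h1 h2
    have e1 : (k : ℝ) < ((m + 1 : ℤ) : ℝ) := by push_cast; linarith
    have e2 : (m : ℝ) < l := by linarith
    have e1 : k < m + 1 := by exact_mod_cast e1
    have e2 : m < l := by exact_mod_cast e2
    omega
  apply IsPreconnected.subset_of_closure_inter_subset isPreconnected_connectedComponentIn
    (isOpen_Ioo.prod isOpen_Ioo)
  · exact ⟨z, mem_connectedComponentIn hz, hzU⟩
  · rintro u ⟨hu, huc⟩
    have hup := connectedComponentIn_subset _ _ huc
    have hcl : u ∈ Set.Icc (a : ℝ) b ×ˢ Set.Icc (c : ℝ) d := by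
      have : closure (Set.Ioo (a : ℝ) b ×ˢ Set.Ioo (c : ℝ) d) ⊆ Set.Icc (a : ℝ) b ×ˢ Set.Icc (c : ℝ) d :=
        closure_minimal (Set.prod_mono Set.Ioo_subset_Icc_self Set.Ioo_subset_Icc_self)
          (isClosed_Icc.prod isClosed_Icc)
      exact this hu
    obtain ⟨⟨h1, h2⟩, h3, h4⟩ := hcl
    refine ⟨⟨lt_of_le_of_ne h1 ?_, lt_of_le_of_ne h2 ?_⟩, lt_of_le_of_ne h3 ?_, lt_of_le_of_ne h4 ?_⟩
    · intro h
      obtain ⟨n, hn, hg⟩ := π.plaid_x_int hup h.symm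
      rw [hn] at h3 h4
      obtain ⟨e1, e2⟩ := half h3 h4
      exact (hV n e1 e2).1 hg
    · intro h
      obtain ⟨n, hn, hg⟩ := π.plaid_x_int hup h
      rw [hn] at h3 h4
      obtain ⟨e1, e2⟩ := half h3 h4
      exact (hV n e1 e2).2 hg
    · intro h
      obtain ⟨n, hn, hg⟩ := π.plaid_y_int hup h.symm
      rw [hn] at h1 h2
      obtain ⟨e1, e2⟩ := half h1 h2
      exact (hH n e1 e2).1 hg
    · intro h
      obtain ⟨n, hn, hg⟩ := π.plaid_y_int hup h
      rw [hn] at h1 h2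
      obtain ⟨e1, e2⟩ := half h1 h2
      exact (hH n e1 e2).2 hg

/-- no good edges on lines with number divisible by `ω` -/
lemma no_Lt_mul (M c : ℤ) : ¬ Lt π.ω π.p (π.ω * M) c := by
  intro h
  unfold Lt at h
  rw [LI_iff, sm_zero π.ww_pos] at h; omega

lemma not_goodV_mul (M n : ℤ) : ¬ π.goodV (π.ω * M) n := by
  rw [goodV_iff]; simp [vc, el, π.no_Lt_mul]

lemma not_goodH_mul (m M : ℤ) : ¬ π.goodH m (π.ω * M) := by
  rw [goodH_iff]; simp [hc, el, π.no_Lt_mul]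

/-- open block -/
def oblock (I J : ℤ) : Set (ℝ × ℝ) :=
  Set.Ioo ((π.ω * (π.ω * I) : ℤ) : ℝ) ((π.ω * (π.ω * I) + π.ω : ℤ) : ℝ) ×ˢ
    Set.Ioo ((π.ω * J : ℤ) : ℝ) ((π.ω * J + π.ω : ℤ) : ℝ)

lemma oblock_sub (I J : ℤ) : π.oblock I J ⊆ π.block I J := by
  rintro z ⟨⟨h1, h2⟩, h3, h4⟩
  push_cast at h1 h2 h3 h4
  unfold block
  rw [Set.mem_Icc, Prod.le_def, Prod.le_def]
  simp only
  refine ⟨⟨?_, ?_⟩, ?_, ?_⟩ <;> nlinarith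

lemma confine_block {I J : ℤ} {z : ℝ × ℝ} (hz : z ∈ π.plaidSet) (hzU : z ∈ π.oblock I J) :
    connectedComponentIn π.plaidSet z ⊆ π.oblock I J := by
  apply π.confine _ _ hz hzU
  · intro n _ _
    refine ⟨π.not_goodV_mul _ n, ?_⟩
    rw [show (π.ω : ℤ) * (π.ω * I) + π.ω = π.ω * (π.ω * I + 1) by ring]
    exact π.not_goodV_mul _ n
  · intro m _ _
    refine ⟨π.not_goodH_mul m _, ?_⟩
    rw [show (π.ω : ℤ) * J + π.ω = π.ω * (J + 1) by ring]
    exact π.not_goodH_mul m _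

end Param

/-! ### A polygon of large diameter -/

lemma exists_line {w p : ℤ} (hw : 2 < w) (hcop : IsCoprime (2 * p) w) (J : ℤ) :
    ∃ l, w * J < l ∧ l < w * J + w ∧ sm w (4 * p * l) = 2 := by
  obtain ⟨u, v, huv⟩ := hcop
  set l := w * J + u % w with hl
  have hmod := Int.emod_add_mul_ediv u w
  have hsm : sm w (4 * p * l) = 2 := by
    apply sm_unique (by omega) _ (2 * p * J - v - 2 * p * (u / w)) _ ?_ (by omega) (by omega)
    rw [hl]
    linear_combination (-4 * p) * hmod.symm + 2 * huv
  have hb1 := Int.emod_nonneg u (show w ≠ 0 by omega)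
  have hb2 := Int.emod_lt_of_pos u (show 0 < w by omega)
  refine ⟨l, ?_, by omega, hsm⟩
  rcases hb1.lt_or_eq with h | h
  · omega
  · exfalso
    have : l = w * J := by omega
    rw [this, sm_zero (by omega)] at hsm
    omega

lemma Lt_two {w p n : ℤ} (hw : 2 < w) (hodd : w % 2 = 1) (hcop : IsCoprime (2 * p) w)
    (h : sm w (4 * p * n) = 2) (c : ℤ) : Lt w p n c ↔ w ∣ c - n := by
  have hw0 : 0 < w := by omega
  obtain ⟨t, ht⟩ : ∃ t, 2 * p * n = 1 + w * t := by
    unfold sm at h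
    exact ⟨(4 * p * n + w) / (2 * w), by linarith⟩
  have htodd : ∃ s, t = 2 * s + 1 := by
    rcases Int.even_or_odd t with ⟨s, hs⟩ | ⟨s, hs⟩
    · exfalso
      rw [hs, show 2 * p * n = 2 * (p * n) by ring, show 1 + w * (s + s) = 1 + 2 * (w * s) by ring] at ht
      omega
    · exact ⟨s, hs⟩
  obtain ⟨s, hs⟩ := htodd
  have hn : sm w (2 * p * n + w) = 1 :=
    sm_unique hw0 _ (s + 1) 1 (by rw [ht, hs]; ring) (by omega) (by omega)
  have hd : Lt w p n c ↔ sm w (2 * p * c + w) = 1 := by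
    unfold Lt; rw [LI_iff, h]; omega
  rw [hd]
  constructor
  · intro h1
    obtain ⟨t, ht⟩ := sm_congr_dvd (h1.trans hn.symm)
    exact hcop.symm.dvd_of_dvd_mul_left ⟨2 * t, by linarith⟩
  · rintro ⟨t, ht⟩
    rw [← hn, show 2 * p * c + w = 2 * p * n + w + 2 * w * (p * t) by linear_combination 2 * p * ht]
    exact sm_add_mul hw0 _ _

namespace Param

variable (π : Param)

lemma goodH_start {n : ℤ} (hn : sm π.ω (4 * π.p * n) = 2) (I : ℤ) :
    π.goodH (π.ω * (π.ω * I)) n := by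
  have hw := π.ww_pos
  have hw2 : (2 : ℤ) < π.ω := by have := π.pp_lt; have := π.pp_pos; omega
  rw [goodH_iff]
  have hpw := π.pp_lt
  have hpp := π.pp_pos
  have hel : ∀ c, el π.ω π.p n c = if (π.ω : ℤ) ∣ c - n then 1 else 0 := by
    intro c; unfold el
    rw [if_congr (Lt_two hw2 π.ww_odd π.cop_p hn c) rfl rfl]
  have hf1 : fl π.ω π.p (π.ω * (π.ω * I)) = 2 * π.p * (π.ω * I) := fl_mul hw _ _
  have hf2 : fl π.ω π.p (π.ω * (π.ω * I) + 1) = 2 * π.p * (π.ω * I) := by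
    unfold fl
    apply ediv_between _ _ hw <;> nlinarith
  rw [hc_A (hf2.trans hf1.symm), hf1, hel, hel, if_pos, if_neg]
  · intro h
    have h1 : (π.ω : ℤ) ∣ 1 := by
      have h2 : (π.ω : ℤ) ∣ 2 * (π.ω * (π.ω * I)) - 2 * π.p * (π.ω * I) :=
        ⟨2 * (π.ω * I) - 2 * π.p * I, by ring⟩
      have := dvd_sub h h2
      refine this.trans (dvd_of_eq ?_)
      ring
    have := Int.le_of_dvd (by norm_num) h1
    omega
  · exact ⟨2 * (π.ω * I) - 2 * π.p * I, by ring⟩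

lemma goodH_far {n : ℤ} (hn : sm π.ω (4 * π.p * n) = 2) (I d : ℤ) (hd0 : 0 < d) (hd : d < π.ω)
    (hg : π.goodH (π.ω * (π.ω * I) + d) n) : (π.ω : ℤ) < 2 * (d + 1) := by
  have hw := π.ww_pos
  have hw2 : (2 : ℤ) < π.ω := by have := π.pp_lt; have := π.pp_pos; omega
  have hpw := π.pp_lt
  have hpp := π.pp_pos
  rw [goodH_iff] at hg
  set w : ℤ := (π.ω : ℤ) with hwd
  set p : ℤ := (π.p : ℤ) with hpd
  set m := w * (w * I) + d with hm
  have hb0 := fl_bounds hw p m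
  have hb1 := fl_bounds hw p (m + 1)
  by_contra hcon
  push Not at hcon
  have hel : ∀ k, el w p n (n + k) ≠ 0 → ∃ t, k = w * t := by
    intro k h; unfold el at h
    rw [if_congr (Lt_two hw2 π.ww_odd π.cop_p hn (n + k)) rfl rfl] at h
    have : w ∣ n + k - n := by
      by_contra h0
      rw [if_neg h0] at h; exact h rfl
    rw [add_sub_cancel_left] at this
    exact this
  have : hc w p m n = 0 := by
    unfold hc
    rw [Nat.add_eq_zero_iff, Finset.sum_eq_zero_iff, Finset.sum_eq_zero_iff, and_comm]
    constructor
    · intro k hk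
      rw [Finset.mem_Ioc] at hk
      by_contra hne
      obtain ⟨t, rfl⟩ := hel k hne
      -- 2 * m - w * t ≤ fl m and fl (m+1) < 2 * m + 2 - w * t
      have h1 : w * (2 * m - w * t) ≤ 2 * p * m := by
        have : 2 * m - w * t ≤ fl w p m := by omega
        nlinarith
      have h2 : 2 * p * (m + 1) < w * (2 * m + 2 - w * t) := by
        have : fl w p (m + 1) + 1 ≤ 2 * m + 2 - w * t := by omega
        nlinarith
      have h3 : (2 * w - 2 * p) * d ≤ w * w * (t - (2 * w - 2 * p) * I) := by
        rw [hm] at h1; linarith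
      have h4 : w * w * (t - (2 * w - 2 * p) * I) < (2 * w - 2 * p) * (d + 1) := by
        rw [hm] at h2; linarith
      set s := t - (2 * w - 2 * p) * I
      have h5 : 0 < s := by
        by_contra h
        have h6 : s ≤ 0 := by omega
        have h7 : w * w * s ≤ 0 := mul_nonpos_of_nonneg_of_nonpos (mul_pos hw hw).le h6
        have h8 : 0 < (2 * w - 2 * p) * d := mul_pos (by omega) hd0
        linarith
      have h6 : w * w ≤ w * w * s := le_mul_of_one_le_right (mul_pos hw hw).le (by omega)
      have h7 : (2 * w - 2 * p) * (d + 1) ≤ w * (2 * (d + 1)) := by nlinarith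
      have h8 : w * (2 * (d + 1)) ≤ w * w := mul_le_mul_of_nonneg_left hcon hw.le
      linarith
    · intro k hk
      rw [Finset.mem_Ioc] at hk
      by_contra hne
      obtain ⟨t, rfl⟩ := hel k hne
      have h1 : 2 * p * m < w * (w * t) := by
        have : fl w p m + 1 ≤ w * t := by omega
        nlinarith
      have h2 : w * (w * t) ≤ 2 * p * (m + 1) := by nlinarith
      have h3 : 2 * p * d < w * w * (t - 2 * p * I) := by
        rw [hm] at h1; linarith
      have h4 : w * w * (t - 2 * p * I) ≤ 2 * p * (d + 1) := by
        rw [hm] at h2; linarith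
      set s := t - 2 * p * I
      have h5 : 0 < s := by
        by_contra h
        have h6 : s ≤ 0 := by omega
        have h7 : w * w * s ≤ 0 := mul_nonpos_of_nonneg_of_nonpos (mul_pos hw hw).le h6
        have h8 : 0 < 2 * p * d := mul_pos (by omega) hd0
        linarith
      have h6 : w * w ≤ w * w * s := le_mul_of_one_le_right (mul_pos hw hw).le (by omega)
      have h7 : 2 * p * (d + 1) ≤ w * (2 * (d + 1)) := by nlinarith
      have h8 : w * (2 * (d + 1)) ≤ w * w := mul_le_mul_of_nonneg_left hcon hw.le
      have h9 : 2 * p * (d + 1) < w * (d + 1) := mul_lt_mul_of_pos_right hpw (by omega)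
      nlinarith
  omega

lemma large_polygon (I J : ℤ) : ∃ Γ : Set (ℝ × ℝ), π.IsPlaidPolygon Γ ∧ Γ ⊆ π.block I J ∧
    ((π.ω : ℝ) / 2 - 1) < Metric.diam Γ := by
  have hw := π.ww_pos
  have hpw := π.pp_lt
  have hpp := π.pp_pos
  have hw2 : (2 : ℤ) < π.ω := by omega
  obtain ⟨n, hn1, hn2, hn⟩ := exists_line hw2 π.cop_p J
  have hg0 := π.goodH_start hn I
  set w : ℤ := (π.ω : ℤ) with hwd
  set m0 : ℤ := w * (w * I) with hm0
  set z0 : ℝ × ℝ := ((m0 : ℝ) + 1 / 2, (n : ℝ)) with hz0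
  have hz0d : z0 ∈ dH m0 n := by refine ⟨rfl, ?_, ?_⟩ <;> simp only [hz0] <;> linarith
  have hz0p : z0 ∈ π.plaidSet := π.dH_sub hg0 hz0d
  have hz0b : z0 ∈ π.oblock I J := by
    have h1 : ((w * J : ℤ) : ℝ) < n := by exact_mod_cast hn1
    have h2 : (n : ℝ) < ((w * J + w : ℤ) : ℝ) := by exact_mod_cast hn2
    have h3 : (2 : ℝ) < (w : ℝ) := by exact_mod_cast hw2
    refine ⟨⟨?_, ?_⟩, h1, h2⟩
    · show ((m0 : ℤ) : ℝ) < m0 + 1 / 2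
      linarith
    · show (m0 : ℝ) + 1 / 2 < ((m0 + w : ℤ) : ℝ)
      push_cast; linarith
  set Γ := connectedComponentIn π.plaidSet z0 with hΓ
  have hsub : Γ ⊆ π.oblock I J := π.confine_block hz0p hz0b
  have hbdd : Bornology.IsBounded Γ := by
    refine Bornology.IsBounded.subset ?_ (hsub.trans (π.oblock_sub I J))
    unfold block; exact Metric.isBounded_Icc _ _
  refine ⟨Γ, ⟨z0, hz0p, rfl⟩, hsub.trans (π.oblock_sub I J), ?_⟩
  set s : ℤ → ℤ → ZMod 2 := fun m n =>
    if (((m : ℝ) + 1 / 2, (n : ℝ) + 1 / 2) : ℝ × ℝ) ∈ Γ then 1 else 0 with hs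
  have sH : ∀ m n, (gh w π.p m (n + 1) : ZMod 2) * s m (n + 1) = gh w π.p m (n + 1) * s m n := by
    intro m n
    unfold gh
    split_ifs with h
    · have hg : π.goodH m (n + 1) := (π.goodH_iff _ _).mpr h
      have : ((((m : ℝ) + 1 / 2, ((n + 1 : ℤ) : ℝ) + 1 / 2) : ℝ × ℝ) ∈ Γ) ↔
          ((((m : ℝ) + 1 / 2, (n : ℝ) + 1 / 2) : ℝ × ℝ) ∈ Γ) := by
        have d1 : (((m : ℝ) + 1 / 2, ((n + 1 : ℤ) : ℝ) + 1 / 2) : ℝ × ℝ) ∈ dH m (n + 1) := by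
          refine ⟨rfl, ?_, ?_⟩ <;> push_cast <;> linarith
        have d2 : (((m : ℝ) + 1 / 2, (n : ℝ) + 1 / 2) : ℝ × ℝ) ∈ dH m (n + 1) := by
          refine ⟨rfl, ?_, ?_⟩ <;> push_cast <;> linarith
        exact ⟨π.same_comp (dH_conn _ _) (π.dH_sub hg) d1 d2,
          π.same_comp (dH_conn _ _) (π.dH_sub hg) d2 d1⟩
      simp only [hs]; rw [if_congr this rfl rfl]
    · simp
  have sV : ∀ m n, (gv w π.p (m + 1) n : ZMod 2) * s (m + 1) n = gv w π.p (m + 1) n * s m n := by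
    intro m n
    unfold gv
    split_ifs with h
    · have hg : π.goodV (m + 1) n := (π.goodV_iff _ _).mpr h
      have : (((((m + 1 : ℤ) : ℝ) + 1 / 2, (n : ℝ) + 1 / 2) : ℝ × ℝ) ∈ Γ) ↔
          ((((m : ℝ) + 1 / 2, (n : ℝ) + 1 / 2) : ℝ × ℝ) ∈ Γ) := by
        have d1 : ((((m + 1 : ℤ) : ℝ) + 1 / 2, (n : ℝ) + 1 / 2) : ℝ × ℝ) ∈ dV (m + 1) n := by
          refine ⟨rfl, ?_, ?_⟩ <;> push_cast <;> linarith
        have d2 : (((m : ℝ) + 1 / 2, (n : ℝ) + 1 / 2) : ℝ × ℝ) ∈ dV (m + 1) n := by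
          refine ⟨rfl, ?_, ?_⟩ <;> push_cast <;> linarith
        exact ⟨π.same_comp (dV_conn _ _) (π.dV_sub hg) d1 d2,
          π.same_comp (dV_conn _ _) (π.dV_sub hg) d2 d1⟩
      simp only [hs]; rw [if_congr this rfl rfl]
    · simp
  have hrect := rect_parity (fun m n => (gh w π.p m n : ZMod 2) * s m n)
    (fun m n => (gv w π.p m n : ZMod 2) * s m n) m0 (m0 + w) n (w * J + w) (by omega) (by omega)
    (by
      intro m n _ _ _ _
      rw [sH, sV]
      linear_combination s m n * good_parity hpp hpw π.ww_odd m n)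
  have gh0 : ∀ m M, gh w π.p m (w * M) = 0 := by
    intro m M; unfold gh; rw [if_neg]; rw [← π.goodH_iff]; exact π.not_goodH_mul m M
  have gv0 : ∀ M n, gv w π.p (w * M) n = 0 := by
    intro m M; unfold gv; rw [if_neg]; rw [← π.goodV_iff]; exact π.not_goodV_mul m M
  have e2 : m0 + w = w * (w * I + 1) := by rw [hm0]; ring
  have e3 : w * J + w = w * (J + 1) := by ring
  rw [Finset.sum_eq_zero (s := Finset.Ico m0 (m0 + w)) (f := fun m => (gh w π.p m (w * J + w) : ZMod 2) * s m (w * J + w)),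
    Finset.sum_eq_zero (s := Finset.Ico n (w * J + w)) (f := fun n => (gv w π.p m0 n : ZMod 2) * s m0 n),
    Finset.sum_eq_zero (s := Finset.Ico n (w * J + w)) (f := fun n => (gv w π.p (m0 + w) n : ZMod 2) * s (m0 + w) n)] at hrect
  rotate_left
  · intro k _; rw [e2, gv0]; simp
  · intro k _; rw [hm0, gv0]; simp
  · intro k _; rw [e3, gh0]; simp
  have hm0mem : m0 ∈ Finset.Ico m0 (m0 + w) := by simp [hw]
  have hex : ∃ m ∈ Finset.Ico m0 (m0 + w), m ≠ m0 ∧ (gh w π.p m n : ZMod 2) * s m n ≠ 0 := by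
    by_contra hcon
    push Not at hcon
    rw [Finset.sum_eq_single m0 (fun m hm hne => hcon m hm hne) (fun h => absurd hm0mem h)] at hrect
    have h1 : gh w π.p m0 n = 1 := by
      unfold gh; rw [if_pos]; rwa [← π.goodH_iff]
    have h2 : s m0 n = 1 := by
      simp only [hs]; rw [if_pos]
      refine π.same_comp (dH_conn m0 n) (π.dH_sub hg0) hz0d ?_ (mem_connectedComponentIn hz0p)
      refine ⟨rfl, ?_, ?_⟩ <;> dsimp only <;> linarith
    rw [h1, h2] at hrect
    simp at hrect
  obtain ⟨m, hm, hne, hnz⟩ := hex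
  rw [Finset.mem_Ico] at hm
  have hgood : π.goodH m n := by
    rw [π.goodH_iff]
    by_contra h
    apply hnz
    have : gh w π.p m n = 0 := by unfold gh; rw [if_neg h]
    rw [this]; simp
  have hmem : (((m : ℝ) + 1 / 2, (n : ℝ) + 1 / 2) : ℝ × ℝ) ∈ Γ := by
    by_contra h
    apply hnz
    have : s m n = 0 := by simp only [hs]; rw [if_neg h]
    rw [this]; simp
  have hfar := π.goodH_far hn I (m - m0) (by omega) (by omega) (by
    rw [show (π.ω : ℤ) * (π.ω * I) + (m - m0) = m by rw [hm0]; ring]; exact hgood)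
  have hdist := Metric.dist_le_diam_of_mem hbdd hmem (mem_connectedComponentIn hz0p)
  have hd2 : (m : ℝ) - m0 ≤ dist (((m : ℝ) + 1 / 2, (n : ℝ) + 1 / 2) : ℝ × ℝ) z0 := by
    rw [Prod.dist_eq]
    refine le_trans ?_ (le_max_left _ _)
    rw [Real.dist_eq]
    refine le_trans (le_of_eq ?_) (le_abs_self _)
    simp only [hz0]; ring
  have hfar' : (π.ω : ℝ) < 2 * ((m : ℝ) - m0 + 1) := by exact_mod_cast hfar
  linarith

end Param

/-! ### Diophantine lemmas -/

open Filter in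
lemma gap_lemma {α : ℝ} (hα : Irrational α) {a : ℕ → ℝ} (ha : Tendsto a atTop (nhds α)) (D : ℕ) :
    ∃ η : ℝ, 0 < η ∧ ∀ᶠ k in atTop, ∀ d : ℕ, 1 ≤ d → d ≤ D → ∀ z : ℤ, η < |a k * d - z| := by
  induction D with
  | zero => exact ⟨1, one_pos, Eventually.of_forall fun k d h1 h2 => by omega⟩
  | succ D ih =>
    obtain ⟨η, hη, hev⟩ := ih
    set x := α * ((D + 1 : ℕ) : ℝ) with hx
    have hirr : Irrational x := hα.mul_natCast (by omega)
    set δ := |x - round x| with hδ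
    have hδ0 : 0 < δ := abs_pos.mpr (sub_ne_zero.mpr (hirr.ne_int _))
    have hlim : Tendsto (fun k => a k * ((D + 1 : ℕ) : ℝ)) atTop (nhds x) := ha.mul_const _
    have hev2 := (Metric.tendsto_nhds.mp hlim) (δ / 2) (by linarith)
    refine ⟨min η (δ / 2), by positivity, ?_⟩
    filter_upwards [hev, hev2] with k h1 h2 d hd1 hd2 z
    rcases Nat.lt_or_ge d (D + 1) with h | h
    · exact (min_le_left _ _).trans_lt (h1 d hd1 (by omega) z)
    · have : d = D + 1 := by omega
      subst this
      refine (min_le_right _ _).trans_lt ?_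
      rw [Real.dist_eq] at h2
      have h3 : δ ≤ |x - z| := round_le x z
      have h4 : |x - z| ≤ |a k * ((D + 1 : ℕ) : ℝ) - x| + |a k * ((D + 1 : ℕ) : ℝ) - z| := by
        rw [abs_sub_comm (a k * _) x]; exact abs_sub_le _ _ _
      linarith

lemma exists_small {α : ℝ} (hα : Irrational α) {ε : ℝ} (hε : 0 < ε) :
    ∃ S T : ℤ, 0 < α * S - T ∧ α * S - T < ε := by
  have hd := (dense_addSubgroupClosure_pair_iff (a := α) (b := 1)).mpr (by simpa using hα)
  obtain ⟨y, hy, h1, h2⟩ := hd.exists_between hε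
  rw [SetLike.mem_coe, AddSubgroup.mem_closure_pair] at hy
  obtain ⟨m, n, h⟩ := hy
  simp only [zsmul_eq_mul] at h
  first
  | exact ⟨m, -n, by push_cast; linarith, by push_cast; linarith⟩
  | exact ⟨n, -m, by push_cast; linarith, by push_cast; linarith⟩

lemma density_core {a θ ε : ℝ} {S T : ℤ} (hθ : a * S - T = θ) (h0 : 0 < θ) (h1 : θ < ε)
    {J : ℕ} (hJ : 1 / θ ≤ J) (y : ℝ) (n0 : ℤ) :
    ∃ n : ℤ, n0 ≤ n ∧ n < n0 + (S.natAbs * (J + 1) + 1 : ℕ) ∧ ∃ z : ℤ, y < a * n - z ∧ a * n - z < y + ε := by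
  have key : ∀ n1 : ℤ, ∃ j : ℕ, j ≤ J + 1 ∧ ∃ z : ℤ, y < a * (n1 + j * S : ℤ) - z ∧
      a * (n1 + j * S : ℤ) - z < y + ε := by
    intro n1
    set z0 := ⌈a * n1 - y⌉
    have hz1 := Int.le_ceil (a * n1 - y)
    have hz2 := Int.ceil_lt_add_one (a * n1 - y)
    set u := a * n1 - z0 with hu
    have hyu0 : 0 ≤ y - u := by rw [hu]; linarith
    have hyu1 : y - u < 1 := by rw [hu]; linarith
    set i := ⌊(y - u) / θ⌋₊
    have hi1 := Nat.floor_le (show 0 ≤ (y - u) / θ by positivity)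
    have hi2 := Nat.lt_floor_add_one ((y - u) / θ)
    rw [le_div_iff₀ h0] at hi1
    rw [div_lt_iff₀ h0] at hi2
    refine ⟨i + 1, ?_, z0 + (i + 1) * T, ?_, ?_⟩
    · have : (i : ℝ) ≤ J := by
        refine le_trans ?_ hJ
        rw [le_div_iff₀ h0]; linarith
      have : i ≤ J := by exact_mod_cast this
      omega
    · have : a * (n1 + (i + 1 : ℕ) * S : ℤ) - (z0 + (i + 1) * T : ℤ) = u + (i + 1) * θ := by
        rw [hu, ← hθ]; push_cast; ring
      rw [this]; linarith
    · have : a * (n1 + (i + 1 : ℕ) * S : ℤ) - (z0 + (i + 1) * T : ℤ) = u + (i + 1) * θ := by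
        rw [hu, ← hθ]; push_cast; ring
      rw [this]; linarith
  have hnn : ∀ j : ℕ, j ≤ J + 1 → (j : ℤ) * S.natAbs ≤ S.natAbs * (J + 1) := by
    intro j hj
    have : (j : ℤ) ≤ J + 1 := by exact_mod_cast hj
    nlinarith [Int.natCast_nonneg S.natAbs]
  rcases le_total 0 S with hS | hS
  · obtain ⟨j, hj, z, h⟩ := key n0
    refine ⟨n0 + j * S, ?_, ?_, z, h⟩
    · have : 0 ≤ (j : ℤ) * S := by positivity
      omega
    · have := hnn j hj
      rw [Int.natAbs_of_nonneg hS] at this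
      push_cast
      rw [abs_of_nonneg hS]
      linarith
  · obtain ⟨j, hj, z, h⟩ := key (n0 + S.natAbs * (J + 1))
    refine ⟨_, ?_, ?_, z, h⟩
    · have := hnn j hj
      rw [Int.ofNat_natAbs_of_nonpos hS] at this ⊢
      linarith
    · have : (j : ℤ) * S ≤ 0 := mul_nonpos_of_nonneg_of_nonpos (by positivity) hS
      push_cast
      linarith

open Filter in
lemma density_lemma {α : ℝ} (hα : Irrational α) {a : ℕ → ℝ} (ha : Tendsto a atTop (nhds α))
    {ε : ℝ} (hε : 0 < ε) : ∃ C : ℕ, ∀ᶠ k in atTop, ∀ (y : ℝ) (n0 : ℤ),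
      ∃ n : ℤ, n0 ≤ n ∧ n < n0 + C ∧ ∃ z : ℤ, y < a k * n - z ∧ a k * n - z < y + ε := by
  obtain ⟨S, T, h1, h2⟩ := exists_small hα hε
  set θ := α * S - T with hθ
  have hlim : Tendsto (fun k => a k * S - T) atTop (nhds θ) := (ha.mul_const _).sub_const _
  obtain ⟨J, hJ⟩ := exists_nat_ge (2 / θ)
  refine ⟨S.natAbs * (J + 1) + 1, ?_⟩
  filter_upwards [hlim.eventually_const_lt (show θ / 2 < θ by linarith),
    hlim.eventually_lt_const h2] with k e1 e2 y n0
  refine density_core rfl (by linarith) e2 ?_ y n0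
  refine le_trans ?_ hJ
  rw [div_le_div_iff₀ (by linarith) h1]
  linarith

/-! ### Producing good edges -/

lemma nrm_unique {x r : ℝ} {z : ℤ} (h : x = r + 2 * z) (h1 : -1 ≤ r) (h2 : r < 1) : nrm x = r := by
  unfold nrm
  have : ⌊(x + 1) / 2⌋ = z := by
    rw [Int.floor_eq_iff, h]; constructor <;> linarith
  rw [this, h]; ring

lemma nrm_spec (x : ℝ) : -1 ≤ nrm x ∧ nrm x < 1 ∧ ∃ z : ℤ, x = nrm x + 2 * z := by
  unfold nrm
  have h1 := Int.floor_le ((x + 1) / 2)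
  have h2 := Int.lt_floor_add_one ((x + 1) / 2)
  refine ⟨by linarith, by linarith, _, by ring⟩

lemma lightPair_pos {a b : ℝ} (ha : 0 < a) : lightPair a b ↔ 0 < b ∧ b < a := by
  unfold lightPair
  rw [gt_iff_lt, mul_pos_iff_of_pos_left ha, abs_of_pos ha]
  constructor
  · rintro ⟨h1, h2⟩; rw [abs_of_pos h1] at h2; exact ⟨h1, h2⟩
  · rintro ⟨h1, h2⟩; rw [abs_of_pos h1]; exact ⟨h1, h2⟩

namespace Param

variable (π : Param)

lemma fl_eq {m F : ℤ} (h1 : (F : ℝ) ≤ π.P * m) (h2 : π.P * m < F + 1) : fl π.ω π.p m = F := by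
  have hwR := π.wR_pos
  unfold fl
  rw [P_eq, div_mul_eq_mul_div] at h1 h2
  rw [le_div_iff₀ hwR] at h1
  rw [div_lt_iff₀ hwR] at h2
  apply ediv_between _ _ π.ww_pos
  · have : F * π.ω ≤ 2 * π.p * m := by exact_mod_cast h1
    linarith
  · have : 2 * π.p * m < (F + 1) * π.ω := by exact_mod_cast h2
    linarith

lemma GE_core {m F : ℤ} {f ρ τ : ℝ} {C : ℕ} (hf : π.P * m = F + f) (hf0 : 0 < f) (hf1 : 2 * f < 1)
    (hτ1 : τ ≤ 2 * f) (hτ2 : τ ≤ ρ) (hρ : 0 < ρ)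
    (hΔ : ∀ z : ℤ, ρ ≤ |π.P * (2 * m - 2 * F - 1) - 2 * z|)
    (hC : ∀ (y : ℝ) (n0 : ℤ), ∃ n : ℤ, n0 ≤ n ∧ n < n0 + C ∧
      ∃ z : ℤ, y < π.P / 2 * n - z ∧ π.P / 2 * n - z < y + τ / 2) (c0 : ℤ) :
    ∃ n, c0 ≤ n ∧ n < c0 + C ∧ π.goodV m n := by
  have hfl : fl π.ω π.p m = F := π.fl_eq (by linarith) (by linarith)
  have hβ : nrm (2 * π.P * m) = 2 * f :=
    nrm_unique (z := F) (by linear_combination 2 * hf) (by linarith) hf1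
  have hlt : ∀ c : ℤ, Lt π.ω π.p m c ↔ 0 < nrm (π.P * c + 1) ∧ nrm (π.P * c + 1) < 2 * f := by
    intro c; rw [← light_iff, hβ, lightPair_pos (by linarith)]
  obtain ⟨d1, d2, zΔ, hz⟩ := nrm_spec (π.P * (2 * m - 2 * F - 1))
  set Δ := nrm (π.P * (2 * m - 2 * F - 1)) with hΔd
  have hΔ' := hΔ zΔ
  rw [show π.P * (2 * m - 2 * F - 1) - 2 * zΔ = Δ by linarith] at hΔ'
  have fin : ∀ n : ℤ, Lt π.ω π.p m (n + F + 1) → ¬ Lt π.ω π.p m (n + 2 * m - F) → π.goodV m n := by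
    intro n h1 h2
    rw [goodV_iff]; unfold vc el; rw [hfl, if_pos h1, if_neg h2]
  have e2 : ∀ n : ℤ, ∀ v : ℝ, ∀ z : ℤ, π.P * (n + F + 1 : ℤ) + 1 = v + 2 * z →
      π.P * (n + 2 * m - F : ℤ) + 1 = v + Δ + 2 * ((z + zΔ : ℤ) : ℝ) := by
    intro n v z h
    push_cast at h ⊢
    linear_combination h + hz
  rcases le_abs.mp hΔ' with hpos | hneg
  · -- Δ ≥ ρ
    obtain ⟨c, h1, h2, z, h3, h4⟩ := hC ((2 * f - τ - 1) / 2) (c0 + F + 1)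
    refine ⟨c - F - 1, by omega, by omega, fin _ ?_ ?_⟩
    · rw [hlt]
      have : nrm (π.P * (c - F - 1 + F + 1 : ℤ) + 1) = π.P * c + 1 - 2 * z := by
        apply nrm_unique (z := z)
        · push_cast; ring
        · linarith
        · linarith
      rw [this]; constructor <;> linarith
    · rw [hlt]
      have e := e2 (c - F - 1) (π.P * c + 1 - 2 * z) z (by push_cast; ring)
      set v := π.P * c + 1 - 2 * z with hv
      have hv1 : 2 * f - τ < v := by rw [hv]; linarith
      have hv2 : v < 2 * f := by rw [hv]; linarith
      by_cases hlt1 : v + Δ < 1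
      · rw [nrm_unique e (by linarith) hlt1]; intro h; linarith
      · rw [nrm_unique (r := v + Δ - 2) (z := z + zΔ + 1) (by rw [e]; push_cast; ring) (by linarith)
          (by linarith)]
        intro h; linarith
  · -- Δ ≤ -ρ
    obtain ⟨c, h1, h2, z, h3, h4⟩ := hC (-1 / 2) (c0 + F + 1)
    refine ⟨c - F - 1, by omega, by omega, fin _ ?_ ?_⟩
    · rw [hlt]
      have : nrm (π.P * (c - F - 1 + F + 1 : ℤ) + 1) = π.P * c + 1 - 2 * z := by
        apply nrm_unique (z := z)
        · push_cast; ring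
        · linarith
        · linarith
      rw [this]; constructor <;> linarith
    · rw [hlt]
      have e := e2 (c - F - 1) (π.P * c + 1 - 2 * z) z (by push_cast; ring)
      set v := π.P * c + 1 - 2 * z with hv
      have hv1 : 0 < v := by rw [hv]; linarith
      have hv2 : v < τ := by rw [hv]; linarith
      rw [nrm_unique e (by linarith) (by linarith)]; intro h; linarith

end Param

open Filter in
lemma GE_lemma {α : ℝ} (hα : Irrational α) {π : ℕ → Param}
    (ha : Tendsto (fun k => (π k).P) atTop (nhds α)) {η : ℝ} (hη : 0 < η) :
    ∃ D : ℕ, ∀ᶠ k in atTop, ∀ a b c d : ℤ, a + D < b → c + D < d →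
      ∃ m n : ℤ, a < m ∧ m < b ∧ c ≤ n ∧ n < d ∧ (π k).goodV m n ∧
        |nrm (2 * (π k).P * m)| ≤ η := by
  -- shrink η
  obtain ⟨η, hηle, hη, hη1⟩ : ∃ η' : ℝ, η' ≤ η ∧ 0 < η' ∧ η' ≤ 1 / 2 :=
    ⟨min η (1 / 2), min_le_left _ _, by positivity, min_le_right _ _⟩
  have h1α : 0 < |1 - α| := abs_pos.mpr (sub_ne_zero.mpr (by
    intro h; exact hα.ne_int 1 (by rw [← h]; simp)))
  obtain ⟨S, T, hST0, hST1⟩ := exists_small hα (ε := min (η / 8) |1 - α|) (by positivity)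
  have hSTlt : α * S - T < η / 8 := hST1.trans_le (min_le_left _ _)
  have hST2 : α * S - T < |1 - α| := hST1.trans_le (min_le_right _ _)
  have hne : S ≠ T := by
    intro h
    subst h
    have hS : S ≠ 0 := by intro h; rw [h] at hST0; simp at hST0
    have h1 : (1 : ℝ) ≤ |(S : ℝ)| := by
      rw [← Int.cast_abs]; exact_mod_cast Int.one_le_abs hS
    have h2 : |α * S - S| = |1 - α| * |(S : ℝ)| := by
      rw [← abs_mul, abs_sub_comm]; congr 1; ring
    rw [abs_of_pos hST0] at h2
    nlinarith
  obtain ⟨ρ, hρ, hgap⟩ := gap_lemma hα ha (S - T).natAbs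
  set τ := min ρ (η / 4) with hτ
  have hτ0 : 0 < τ := by positivity
  obtain ⟨C1, hC1⟩ := density_lemma hα ha (ε := η / 8) (by positivity)
  have hα2 : Irrational (α / 2) := by
    have := hα.div_natCast (m := 2) (by norm_num)
    simpa using this
  obtain ⟨C2, hC2⟩ := density_lemma hα2 (ha.div_const 2) (ε := τ / 2) (by positivity)
  have hlim : Tendsto (fun k => (π k).P * S - T) atTop (nhds (α * S - T)) :=
    (ha.mul_const _).sub_const _
  refine ⟨C1 + 2 * S.natAbs + 2 + C2, ?_⟩
  filter_upwards [hgap, hC1, hC2, hlim.eventually_const_lt hST0, hlim.eventually_lt_const hSTlt]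
    with k g1 g2 g3 g4 g5 a b c d hab hcd
  simp only [Nat.cast_add, Nat.cast_mul, Nat.cast_ofNat] at hab hcd
  obtain ⟨m1, hm1, hm2, F, hF1, hF2⟩ := g2 (η / 8) (a + 1 + S.natAbs)
  -- the two candidates
  have gapd : ∀ z : ℤ, ρ < |(π k).P * (S - T) - z| := by
    intro z
    have h1 : 1 ≤ (S - T).natAbs := by omega
    rcases le_total 0 (S - T) with h | h
    · have := g1 _ h1 le_rfl z
      rwa [show (((S - T).natAbs : ℕ) : ℝ) = S - T by
        rw [Nat.cast_natAbs, abs_of_nonneg h]; push_cast; ring] at this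
    · have := g1 _ h1 le_rfl (-z)
      rw [show (((S - T).natAbs : ℕ) : ℝ) = -(S - T) by
        rw [Nat.cast_natAbs, abs_of_nonpos h]; push_cast; ring] at this
      rw [show (π k).P * -((S : ℝ) - T) - ((-z : ℤ) : ℝ) = -((π k).P * (S - T) - z) by
        push_cast; ring, abs_neg] at this
      exact this
  have main : ∀ (m G : ℤ) (f : ℝ), (π k).P * m = G + f → η / 8 < f → f < 3 * η / 8 →
      a < m → m < b → (∀ z : ℤ, ρ ≤ |(π k).P * (2 * m - 2 * G - 1) - 2 * z|) →
      ∃ m n : ℤ, a < m ∧ m < b ∧ c ≤ n ∧ n < d ∧ (π k).goodV m n ∧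
        |nrm (2 * (π k).P * m)| ≤ η := by
    intro m G f h1 h2 h3 h4 h5 h6
    obtain ⟨n, hn1, hn2, hn3⟩ := (π k).GE_core h1 (by linarith) (by linarith)
      ((min_le_right ρ (η / 4)).trans (by linarith)) (min_le_left ρ (η / 4)) hρ h6 g3 c
    refine ⟨m, n, h4, h5, hn1, by omega, hn3, ?_⟩
    rw [nrm_unique (r := 2 * f) (z := G) (by linear_combination 2 * h1) (by linarith) (by linarith),
      abs_of_pos (by linarith)]
    linarith
  have hres : ∃ m n : ℤ, a < m ∧ m < b ∧ c ≤ n ∧ n < d ∧ (π k).goodV m n ∧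
        |nrm (2 * (π k).P * m)| ≤ η := by
    by_cases hcase : ∀ z : ℤ, ρ ≤ |(π k).P * (2 * m1 - 2 * F - 1) - 2 * z|
    · exact main m1 F ((π k).P * m1 - F) (by ring) hF1 (by linarith) (by omega) (by omega) hcase
    · push Not at hcase
      obtain ⟨z1, hz1⟩ := hcase
      refine main (m1 + S) (F + T) ((π k).P * m1 - F + ((π k).P * S - T)) (by push_cast; ring)
        (by linarith) (by linarith) (by omega) (by omega) ?_
      intro z
      have h1 := gapd (z - z1)
      have h2 : (π k).P * (2 * ((m1 + S : ℤ) : ℝ) - 2 * ((F + T : ℤ) : ℝ) - 1) - 2 * z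
          = 2 * ((π k).P * (S - T) - ((z - z1 : ℤ) : ℝ))
            + ((π k).P * (2 * m1 - 2 * F - 1) - 2 * z1) := by push_cast; ring
      rw [h2]
      have h3 := abs_sub_abs_le_abs_add (2 * ((π k).P * (S - T) - ((z - z1 : ℤ) : ℝ)))
        ((π k).P * (2 * m1 - 2 * F - 1) - 2 * z1)
      rw [abs_mul, abs_two] at h3
      linarith
  obtain ⟨m, n, r1, r2, r3, r4, r5, r6⟩ := hres
  exact ⟨m, n, r1, r2, r3, r4, r5, r6.trans hηle⟩

/-! ### Conclusion -/

namespace Param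

variable (π : Param)

lemma nrm_le_of_sm {l : ℤ} {K : ℕ} {η : ℝ} (hK : 2 * (K : ℝ) ≤ η * ((π.ω : ℤ) : ℝ))
    (h : (sm π.ω (4 * π.p * l)).natAbs ≤ 2 * K) : |nrm (2 * π.P * l)| ≤ η := by
  have hw := π.wR_pos
  rw [nrm_line, abs_div, abs_of_pos hw, div_le_iff₀ hw]
  have h2 : |sm π.ω (4 * π.p * l)| ≤ 2 * (K : ℤ) := by rw [Int.abs_eq_natAbs]; omega
  have h3 : |(sm π.ω (4 * π.p * l) : ℝ)| ≤ 2 * (K : ℝ) := by exact_mod_cast h2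
  linarith

lemma nrm_gt_of_sm {l : ℤ} {K : ℕ} {η : ℝ} (hK : η * ((π.ω : ℤ) : ℝ) < 2 * (K : ℝ) + 2)
    (h : 2 * K < (sm π.ω (4 * π.p * l)).natAbs) : η < |nrm (2 * π.P * l)| := by
  have hw := π.wR_pos
  rw [nrm_line, abs_div, abs_of_pos hw, lt_div_iff₀ hw]
  have he := sm_even π.ω π.p l
  have h2 : 2 * (K : ℤ) + 2 ≤ |sm π.ω (4 * π.p * l)| := by
    rw [Int.abs_eq_natAbs]; omega
  have h3 : 2 * (K : ℝ) + 2 ≤ |(sm π.ω (4 * π.p * l) : ℝ)| := by exact_mod_cast h2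
  linarith

lemma far_of_gap {a b : ℤ} {η ρ : ℝ} {D : ℕ} (hab : a < b)
    (ha : |nrm (2 * π.P * a)| ≤ η) (hb : |nrm (2 * π.P * b)| ≤ η) (hη : η ≤ ρ)
    (hgap : ∀ d : ℕ, 1 ≤ d → d ≤ D → ∀ z : ℤ, ρ < |π.P * d - z|) : a + D < b := by
  by_contra hcon
  obtain ⟨-, -, z1, h1⟩ := nrm_spec (2 * π.P * a)
  obtain ⟨-, -, z2, h2⟩ := nrm_spec (2 * π.P * b)
  have h := hgap (b - a).toNat (by omega) (by omega) (z2 - z1)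
  have hc : (((b - a).toNat : ℕ) : ℝ) = b - a := by
    have : (((b - a).toNat : ℕ) : ℤ) = b - a := Int.toNat_of_nonneg (by omega)
    exact_mod_cast this
  rw [hc, show π.P * ((b : ℝ) - a) - ((z2 - z1 : ℤ) : ℝ)
    = (nrm (2 * π.P * b) - nrm (2 * π.P * a)) / 2 by push_cast; linarith] at h
  rw [abs_le] at ha hb
  have : |(nrm (2 * π.P * b) - nrm (2 * π.P * a)) / 2| ≤ η := by
    rw [abs_le]; constructor <;> linarith [ha.1, ha.2, hb.1, hb.2]
  linarith

end Param

open Filter in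
lemma step_lemma {α : ℝ} (hα : Irrational α) {π : ℕ → Param}
    (ha : Tendsto (fun k => (π k).P) atTop (nhds α)) {η : ℝ} (hη : 0 < η) :
    ∃ η' : ℝ, 0 < η' ∧ ∀ᶠ k in atTop, ∀ I J : ℤ, ∃ Γ : Set (ℝ × ℝ),
      (π k).IsPlaidPolygon Γ ∧ Γ ⊆ (π k).block I J ∧
      (∃ z ∈ Γ, ∃ m : ℤ, z.1 = (m : ℝ) ∧ |nrm (2 * (π k).P * m)| ≤ η) ∧
      (∀ z ∈ Γ, ∀ m : ℤ, z.1 = (m : ℝ) → η' < |nrm (2 * (π k).P * m)|) := by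
  obtain ⟨D, hD⟩ := GE_lemma hα ha hη
  obtain ⟨ρ, hρ, hgap⟩ := gap_lemma hα ha D
  refine ⟨min ρ (1 / 2), by positivity, ?_⟩
  set η' := min ρ (1 / 2) with hη'
  have hη0 : 0 < η' := by positivity
  have hη1 : η' ≤ 1 / 2 := min_le_right _ _
  filter_upwards [hD, hgap] with k hGE hg I J
  set w : ℝ := (((π k).ω : ℤ) : ℝ) with hw
  have hwpos : 0 < w := (π k).wR_pos
  have hnn : 0 ≤ η' * w / 2 := by positivity
  set K := ⌊η' * w / 2⌋₊ with hKd
  have hK1 : (K : ℝ) ≤ η' * w / 2 := Nat.floor_le hnn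
  have hK2 : η' * w / 2 < K + 1 := Nat.lt_floor_add_one _
  have hKw : 2 * (K : ℤ) < ((π k).ω : ℤ) := by
    have : 2 * (K : ℝ) < (((π k).ω : ℤ) : ℝ) := by rw [← hw]; nlinarith
    exact_mod_cast this
  obtain ⟨a, b, c, d, ha1, hab, hb1, hc1, hcd, hd1, hv, hh, hin, sa, sb, sc, sd⟩ :=
    zero_cell (π k).pp_pos (π k).pp_lt (π k).ww_odd (π k).cop_p ((π k).ω * I) J K hKw
  have hK1' : 2 * (K : ℝ) ≤ η' * w := by linarith
  have hab' := (π k).far_of_gap hab ((π k).nrm_le_of_sm hK1' sa) ((π k).nrm_le_of_sm hK1' sb)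
    (min_le_left ρ (1 / 2)) hg
  have hcd' := (π k).far_of_gap hcd ((π k).nrm_le_of_sm hK1' sc) ((π k).nrm_le_of_sm hK1' sd)
    (min_le_left ρ (1 / 2)) hg
  obtain ⟨m, n, hm1, hm2, hn1, hn2, hgood, hsmall⟩ := hGE a b c d hab' hcd'
  have hz : ((m : ℝ), (n : ℝ) + 1 / 2) ∈ (π k).plaidSet :=
    ⟨m, n, Or.inr (Or.inr (Or.inl ⟨hgood, right_mem_segment ℝ _ _⟩))⟩
  have hzU : ((m : ℝ), (n : ℝ) + 1 / 2) ∈ Set.Ioo (a : ℝ) b ×ˢ Set.Ioo (c : ℝ) d := by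
    have e1 : (a : ℝ) < m := by exact_mod_cast hm1
    have e2 : (m : ℝ) < b := by exact_mod_cast hm2
    have e3 : (c : ℝ) ≤ n := by exact_mod_cast hn1
    have e4 : (n : ℝ) + 1 ≤ d := by exact_mod_cast hn2
    exact ⟨⟨e1, e2⟩, ⟨by linarith, by linarith⟩⟩
  have hconf := (π k).confine
    (fun n h1 h2 => ⟨fun h => (hv n h1 h2).1 (((π k).goodV_iff _ _).mp h),
      fun h => (hv n h1 h2).2 (((π k).goodV_iff _ _).mp h)⟩)
    (fun m h1 h2 => ⟨fun h => (hh m h1 h2).1 (((π k).goodH_iff _ _).mp h),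
      fun h => (hh m h1 h2).2 (((π k).goodH_iff _ _).mp h)⟩) hz hzU
  refine ⟨connectedComponentIn (π k).plaidSet ((m : ℝ), (n : ℝ) + 1 / 2), ⟨_, hz, rfl⟩,
    ?_, ⟨_, mem_connectedComponentIn hz, m, rfl, hsmall⟩, ?_⟩
  · refine hconf.trans (Set.Subset.trans ?_ ((π k).oblock_sub I J))
    unfold Param.oblock
    exact Set.prod_mono (Set.Ioo_subset_Ioo (Int.cast_le.mpr ha1) (Int.cast_le.mpr hb1))
      (Set.Ioo_subset_Ioo (Int.cast_le.mpr hc1) (Int.cast_le.mpr hd1))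
  · intro z hzΓ m' hm'
    obtain ⟨⟨h1, h2⟩, -⟩ := hconf hzΓ
    rw [hm'] at h1 h2
    exact (π k).nrm_gt_of_sm (by linarith)
      (hin m' (by exact_mod_cast h1) (by exact_mod_cast h2))

open Filter in
lemma count_lemma {α : ℝ} (hα : Irrational α) {π : ℕ → Param}
    (ha : Tendsto (fun k => (π k).P) atTop (nhds α)) (N : ℕ) : ∀ η : ℝ, 0 < η →
    ∀ᶠ k in atTop, ∀ I J : ℤ, ∃ S : Finset (Set (ℝ × ℝ)), S.card = N ∧
      ∀ Γ ∈ S, (π k).IsPlaidPolygon Γ ∧ Γ ⊆ (π k).block I J ∧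
      ∃ z ∈ Γ, ∃ m : ℤ, z.1 = (m : ℝ) ∧ |nrm (2 * (π k).P * m)| ≤ η := by
  induction N with
  | zero => exact fun η _ => Eventually.of_forall fun k I J => ⟨∅, rfl, by simp⟩
  | succ N ih =>
    intro η hη
    obtain ⟨η', hη', hstep⟩ := step_lemma hα ha hη
    filter_upwards [hstep, ih (min η η') (by positivity)] with k h1 h2 I J
    obtain ⟨Γ, hΓ1, hΓ2, hΓ3, hΓ4⟩ := h1 I J
    obtain ⟨S, hS, hSp⟩ := h2 I J
    have hnot : Γ ∉ S := by
      intro hmem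
      obtain ⟨-, -, z, hz, m, hm, hsm⟩ := hSp Γ hmem
      have := hΓ4 z hz m hm
      have := hsm.trans (min_le_right η η')
      linarith
    refine ⟨insert Γ S, by rw [Finset.card_insert_of_notMem hnot, hS], ?_⟩
    intro Γ' hΓ'
    rcases Finset.mem_insert.mp hΓ' with rfl | h
    · exact ⟨hΓ1, hΓ2, hΓ3⟩
    · obtain ⟨g1, g2, z, hz, m, hm, hsm⟩ := hSp Γ' h
      exact ⟨g1, g2, z, hz, m, hm, hsm.trans (min_le_left _ _)⟩

open Filter in
lemma P_limit (π : ℕ → Param) (x : ℝ) (hx : Irrational x)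
    (hconv : Tendsto (fun k => ((π k).p : ℝ) / ((π k).q : ℝ)) atTop (nhds x)) :
    ∃ α : ℝ, Irrational α ∧ Tendsto (fun k => (π k).P) atTop (nhds α) := by
  have hx0 : 0 ≤ x := ge_of_tendsto' hconv fun k => by positivity
  refine ⟨2 * x / (1 + x), ?_, ?_⟩
  · rintro ⟨r, hr⟩
    have h1 : (r : ℝ) * (1 + x) = 2 * x := by rw [hr]; field_simp
    have h2 : (2 - (r : ℝ)) ≠ 0 := by
      intro h
      have : (r : ℝ) = 2 := by linarith
      rw [this] at h1
      linarith
    apply hx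
    refine ⟨r / (2 - r), ?_⟩
    push_cast
    rw [div_eq_iff h2]
    linarith
  · have h1 : Tendsto (fun k => 2 * (((π k).p : ℝ) / ((π k).q : ℝ)) /
        (1 + ((π k).p : ℝ) / ((π k).q : ℝ))) atTop (nhds (2 * x / (1 + x))) :=
      (hconv.const_mul 2).div (hconv.const_add 1) (by positivity)
    refine h1.congr fun k => ?_
    have hq : (0 : ℝ) < (π k).q := by
      have := (π k).p_pos; have := (π k).p_lt_q
      exact_mod_cast (by omega : 0 < (π k).q)
    have hp : (0 : ℝ) < (π k).p := by exact_mod_cast (π k).p_pos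
    unfold Param.P Param.ω
    push_cast
    field_simp
    ring

/-- Let `p_k/q_k` be a sequence of even rational parameters converging to an irrational limit,
and let `B_k` be any sequence of associated blocks.  Then for every integer `N`, for all
sufficiently large `k`, the number of distinct plaid polygons contained in `B_k` exceeds `N`,
and the maximum diameter of a plaid polygon contained in `B_k` exceeds `N`. -/
theorem many_large_polygons (π : ℕ → Param) (x : ℝ) (hx : Irrational x)
    (hconv : Filter.Tendsto (fun k => ((π k).p : ℝ) / ((π k).q : ℝ))
      Filter.atTop (nhds x))
    (B : ℕ → ℤ × ℤ) (N : ℕ) :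
    ∀ᶠ k in Filter.atTop,
      (∃ S : Finset (Set (ℝ × ℝ)), N < S.card ∧
        ∀ Γ ∈ S, (π k).IsPlaidPolygon Γ ∧ Γ ⊆ (π k).block (B k).1 (B k).2) ∧
      (∃ Γ : Set (ℝ × ℝ), (π k).IsPlaidPolygon Γ ∧ Γ ⊆ (π k).block (B k).1 (B k).2 ∧
        (N : ℝ) < Metric.diam Γ) := by
  obtain ⟨α, hα, ha⟩ := P_limit π x hx hconv
  obtain ⟨ρ, hρ, hgap⟩ := gap_lemma hα ha (2 * N + 2)
  filter_upwards [count_lemma hα ha (N + 1) 1 one_pos, hgap] with k h1 h2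
  constructor
  · obtain ⟨S, hS, hSp⟩ := h1 (B k).1 (B k).2
    exact ⟨S, by omega, fun Γ hΓ => ⟨(hSp Γ hΓ).1, (hSp Γ hΓ).2.1⟩⟩
  · obtain ⟨Γ, g1, g2, g3⟩ := (π k).large_polygon (B k).1 (B k).2
    refine ⟨Γ, g1, g2, lt_of_le_of_lt ?_ g3⟩
    have hω : 2 * N + 2 < (π k).ω := by
      by_contra hcon
      have hpos := (π k).ww_pos
      have h3 := h2 (π k).ω (by omega) (by omega) (2 * (π k).p)
      have hne : ((π k).ω : ℝ) ≠ 0 := by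
        have : (π k).ω ≠ 0 := by omega
        exact_mod_cast this
      have h4 : (π k).P * (π k).ω - ((2 * (π k).p : ℤ) : ℝ) = 0 := by
        unfold Param.P
        rw [div_mul_cancel₀ _ hne]
        push_cast
        ring
      rw [h4, abs_zero] at h3
      linarith
    have hω' : 2 * (N : ℝ) + 2 < (π k).ω := by exact_mod_cast hω
    linarith
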